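/- arXiv:1104.3657 — 7 statements merged into one kernel-verified Lean document; each statement's English description precedes it below -/
import Mathlib

section
/- Let n ≥ 4 and let U ⊆ ℝⁿ be an open neighborhood of 0. Let g : U → Sym²(ℝⁿ)* be a smooth family of symmetric bilinear forms such that every g_p is positive semidefinite with kernel of dimension exactly one (a lightlike metric). Assume g is generic in the following sense: there is a smooth vector field X : U → ℝⁿ with X_p ≠ 0 and g_p(X_p, ·) = 0 for all p ∈ U, such that for every p ∈ U the symmetric bilinear form (L_X g)_p defined by (L_X g)_p(v,w) = (Dg_p(X_p))(v,w) + g_p((DX_p)v, w) + g_p(v, (DX_p)w) has kernel exactly the line ℝ·X_p. Let f : U → ℝⁿ be smooth with f(0) = 0 and suppose that the map p ↦ (f*g)_p − g_p vanishes to order 2 at 0 (i.e. f is a 3-infinitesimal isometry of g at 0). If Df(0) = id, then the second derivative of f at 0 vanishes: D²f(0) = 0. (Generic lightlike metrics are (3,1)-sub-rigid.) -/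
/-- A map from `ℝⁿ` to a normed space vanishes to order `k` at `0`: all its iterated
Fréchet derivatives of order `≤ k` vanish at `0` (order `0` being the value itself). -/
def VanishesToOrderAtZero {n : ℕ} {F : Type*} [NormedAddCommGroup F] [NormedSpace ℝ F]
    (G : (Fin n → ℝ) → F) (k : ℕ) : Prop :=
  ∀ j ≤ k, iteratedFDeriv ℝ j G 0 = 0

/-- The pullback of a continuous bilinear form `B` by a continuous linear map `A`:
`(v, w) ↦ B (A v) (A w)`. -/
noncomputable def pullbackBilin {n : ℕ}
    (B : (Fin n → ℝ) →L[ℝ] (Fin n → ℝ) →L[ℝ] ℝ)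
    (A : (Fin n → ℝ) →L[ℝ] (Fin n → ℝ)) :
    (Fin n → ℝ) →L[ℝ] (Fin n → ℝ) →L[ℝ] ℝ :=
  ((B.comp A).flip.comp A).flip

section

set_option maxSynthPendingDepth 3

/-- If the Kulkarni–Nomizu product of `b` with a symmetric form `h` vanishes, where `h` has a kernel
of dimension at most one in a space of dimension at least four, then `b = 0`. -/
theorem eq_zero_of_kulkarniNomizu_eq_zero {V : Type*} [AddCommGroup V] [Module ℝ V]
    [FiniteDimensional ℝ V] (hV : 4 ≤ Module.finrank ℝ V) {h b : LinearMap.BilinForm ℝ V}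
    (hh : h.IsSymm) {X : V} (hX : ∀ v, (∀ w, h v w = 0) → ∃ t : ℝ, v = t • X)
    (hKN : ∀ x y z w, b x z * h y w + b y w * h x z - b x w * h y z - b y z * h x w = 0) :
    b = 0 := by
  obtain ⟨e, he⟩ := LinearMap.BilinForm.exists_orthogonal_basis
    (LinearMap.BilinForm.isSymm_iff.1 hh)
  have horth : ∀ i j, i ≠ j → h (e i) (e j) = 0 := fun i j hij => he hij
  have hbad : ∀ i j, i ≠ j → h (e i) (e i) = 0 → h (e j) (e j) ≠ 0 := by
    intro i j hij hi hj
    have key : ∀ i, h (e i) (e i) = 0 → ∃ t : ℝ, e i = t • X := by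
      intro i hi
      refine hX _ fun w => ?_
      have : h (e i) = 0 := e.ext fun k => by
        by_cases hk : i = k
        · subst hk; simpa using hi
        · simpa using horth i k hk
      simp [this]
    obtain ⟨s, hs⟩ := key i hi
    obtain ⟨t, ht⟩ := key j hj
    have hs0 : s ≠ 0 := fun h0 => e.ne_zero i (by simp [hs, h0])
    have hrel : e j = (t * s⁻¹) • e i := by
      rw [hs, ht, smul_smul, mul_assoc, inv_mul_cancel₀ hs0, mul_one]
    have := congrArg (fun v => e.repr v j) hrel
    simp [hij] at this
  have hgood : ∀ i j, ∃ k, k ≠ i ∧ k ≠ j ∧ h (e k) (e k) ≠ 0 := by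
    intro i j
    have hcard : 1 < (({i, j} : Finset (Fin (Module.finrank ℝ V)))ᶜ).card := by
      have := Finset.card_le_two (a := i) (b := j)
      rw [Finset.card_compl, Fintype.card_fin]
      omega
    obtain ⟨k, hk, l, hl, hkl⟩ := Finset.one_lt_card.1 hcard
    simp only [Finset.mem_compl, Finset.mem_insert, Finset.mem_singleton, not_or] at hk hl
    by_cases hkk : h (e k) (e k) = 0
    · exact ⟨l, hl.1, hl.2, hbad k l hkl hkk⟩
    · exact ⟨k, hk.1, hk.2, hkk⟩
  have hoff : ∀ i j, i ≠ j → b (e i) (e j) = 0 := by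
    intro i j hij
    obtain ⟨k, hki, hkj, hk⟩ := hgood i j
    have := hKN (e i) (e k) (e j) (e k)
    rw [horth i j hij, horth k j hkj, horth i k hki.symm] at this
    simpa [hk] using this
  have hdiag : ∀ i j, i ≠ j →
      b (e i) (e i) * h (e j) (e j) + b (e j) (e j) * h (e i) (e i) = 0 := by
    intro i j hij
    have := hKN (e i) (e j) (e i) (e j)
    rw [horth i j hij, horth j i hij.symm] at this
    simpa using this
  refine e.ext fun i => e.ext fun j => ?_
  by_cases hij : i = j
  · subst hij
    obtain ⟨j, hji, -, hj⟩ := hgood i i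
    obtain ⟨k, hki, hkj, hk⟩ := hgood i j
    have hprod : b (e i) (e i) * (h (e j) (e j) * h (e k) (e k)) = 0 := by
      linear_combination (h (e k) (e k) * hdiag i j hji.symm + h (e j) (e j) * hdiag i k hki.symm
        - h (e i) (e i) * hdiag j k hkj.symm) / 2
    simpa [hj, hk] using hprod
  · simpa using hoff i j hij

theorem fderiv_bilin_apply {E F : Type*} [NormedAddCommGroup E] [NormedSpace ℝ E]
    [NormedAddCommGroup F] [NormedSpace ℝ F]
    {G : E → F →L[ℝ] F →L[ℝ] ℝ} {a b : E → F} {p : E} (hG : DifferentiableAt ℝ G p)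
    (ha : DifferentiableAt ℝ a p) (hb : DifferentiableAt ℝ b p) (u : E) :
    fderiv ℝ (fun q => G q (a q) (b q)) p u =
      fderiv ℝ G p u (a p) (b p) + G p (fderiv ℝ a p u) (b p) + G p (a p) (fderiv ℝ b p u) := by
  rw [((hG.hasFDerivAt.clm_apply ha.hasFDerivAt).clm_apply hb.hasFDerivAt).fderiv]
  simp
  ring

theorem fderiv_apply_apply {E F : Type*} [NormedAddCommGroup E] [NormedSpace ℝ E]
    [NormedAddCommGroup F] [NormedSpace ℝ F]
    {G : E → F →L[ℝ] F →L[ℝ] ℝ} {p : E} (hG : DifferentiableAt ℝ G p) (u : E) (v w : F) :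
    fderiv ℝ (fun q => G q v w) p u = fderiv ℝ G p u v w := by
  simpa using fderiv_bilin_apply hG (differentiableAt_const v) (differentiableAt_const w) u

theorem fderiv_fderiv_apply_apply {E F : Type*} [NormedAddCommGroup E] [NormedSpace ℝ E]
    [NormedAddCommGroup F] [NormedSpace ℝ F]
    {G : E → F →L[ℝ] F →L[ℝ] ℝ} {p : E} (hG : ContDiffAt ℝ 2 G p) (u u' : E) (v w : F) :
    fderiv ℝ (fun q => fderiv ℝ (fun r => G r v w) q u) p u' =
      fderiv ℝ (fderiv ℝ G) p u' u v w := by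
  have hev : (fun q => fderiv ℝ (fun r => G r v w) q u) =ᶠ[nhds p]
      fun q => fderiv ℝ G q u v w := by
    filter_upwards [hG.eventually (by simp)] with q hq
    exact fderiv_apply_apply (hq.differentiableAt (by simp)) u v w
  have hD : DifferentiableAt ℝ (fderiv ℝ G) p :=
    (hG.fderiv_right (m := 1) (by norm_num)).differentiableAt (by simp)
  rw [hev.fderiv_eq, fderiv_apply_apply (hD.clm_apply (differentiableAt_const u)),
    fderiv_clm_apply hD (differentiableAt_const u)]
  simp

section PullbackJets

variable {E : Type*} [NormedAddCommGroup E] [NormedSpace ℝ E]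
  {g : E → E →L[ℝ] E →L[ℝ] ℝ} {f : E → E} {p : E}

/-- The first derivative of `f^* g`, evaluated on a pair of vectors. -/
theorem fderiv_pullback_apply (hg : DifferentiableAt ℝ g (f p)) (hf : ContDiffAt ℝ 2 f p)
    (u v w : E) :
    fderiv ℝ (fun q => g (f q) (fderiv ℝ f q v) (fderiv ℝ f q w)) p u =
      fderiv ℝ g (f p) (fderiv ℝ f p u) (fderiv ℝ f p v) (fderiv ℝ f p w)
        + g (f p) (fderiv ℝ (fderiv ℝ f) p u v) (fderiv ℝ f p w)
        + g (f p) (fderiv ℝ f p v) (fderiv ℝ (fderiv ℝ f) p u w) := by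
  have hD : DifferentiableAt ℝ (fderiv ℝ f) p :=
    (hf.fderiv_right (m := 1) (by norm_num)).differentiableAt (by simp)
  have hf1 : DifferentiableAt ℝ f p := hf.differentiableAt (by simp)
  have hDv (v : E) : DifferentiableAt ℝ (fun q => fderiv ℝ f q v) p :=
    hD.clm_apply (differentiableAt_const v)
  have hDv' (v : E) : fderiv ℝ (fun q => fderiv ℝ f q v) p u = fderiv ℝ (fderiv ℝ f) p u v := by
    rw [fderiv_clm_apply hD (differentiableAt_const v)]
    simp
  rw [fderiv_bilin_apply (G := fun q => g (f q)) (hg.comp p hf1) (hDv v) (hDv w), hDv', hDv',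
    fderiv_fun_comp p hg hf1]
  rfl

/-- The second derivative of `f^* g` at a fixed point of `f` where `Df = id`. -/
theorem fderiv_fderiv_pullback_apply (hg : ContDiffAt ℝ 2 g p) (hf : ContDiffAt ℝ 3 f p)
    (hfp : f p = p) (hDf : fderiv ℝ f p = ContinuousLinearMap.id ℝ E) (u' u v w : E) :
    fderiv ℝ (fun q => fderiv ℝ
        (fun r => g (f r) (fderiv ℝ f r v) (fderiv ℝ f r w)) q u) p u' =
      fderiv ℝ (fderiv ℝ g) p u' u v w
        + fderiv ℝ g p (fderiv ℝ (fderiv ℝ f) p u' u) v w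
        + fderiv ℝ g p u (fderiv ℝ (fderiv ℝ f) p u' v) w
        + fderiv ℝ g p u v (fderiv ℝ (fderiv ℝ f) p u' w)
        + fderiv ℝ g p u' (fderiv ℝ (fderiv ℝ f) p u v) w
        + fderiv ℝ g p u' v (fderiv ℝ (fderiv ℝ f) p u w)
        + g p (fderiv ℝ (fderiv ℝ (fderiv ℝ f)) p u' u v) w
        + g p v (fderiv ℝ (fderiv ℝ (fderiv ℝ f)) p u' u w)
        + g p (fderiv ℝ (fderiv ℝ f) p u v) (fderiv ℝ (fderiv ℝ f) p u' w)
        + g p (fderiv ℝ (fderiv ℝ f) p u' v) (fderiv ℝ (fderiv ℝ f) p u w) := by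
  have hf1 : DifferentiableAt ℝ f p := hf.differentiableAt (by simp)
  have hDf2 : ContDiffAt ℝ 2 (fderiv ℝ f) p := hf.fderiv_right (by norm_num)
  have hD : DifferentiableAt ℝ (fderiv ℝ f) p := hDf2.differentiableAt (by simp)
  have hDD : DifferentiableAt ℝ (fderiv ℝ (fderiv ℝ f)) p :=
    (hDf2.fderiv_right (m := 1) (by norm_num)).differentiableAt (by simp)
  have hgp : ContDiffAt ℝ 2 g (f p) := hfp.symm ▸ hg
  have hg1 : DifferentiableAt ℝ g (f p) := hgp.differentiableAt (by simp)
  have hDg : DifferentiableAt ℝ (fderiv ℝ g) (f p) :=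
    (hgp.fderiv_right (m := 1) (by norm_num)).differentiableAt (by simp)
  have hDv (v : E) : DifferentiableAt ℝ (fun q => fderiv ℝ f q v) p :=
    hD.clm_apply (differentiableAt_const v)
  have hDv' (v : E) :
      fderiv ℝ (fun q => fderiv ℝ f q v) p u' = fderiv ℝ (fderiv ℝ f) p u' v := by
    rw [fderiv_clm_apply hD (differentiableAt_const v)]
    simp
  have hDDv (v : E) : DifferentiableAt ℝ (fun q => fderiv ℝ (fderiv ℝ f) q u v) p :=
    (hDD.clm_apply (differentiableAt_const u)).clm_apply (differentiableAt_const v)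
  have hDDv' (v : E) : fderiv ℝ (fun q => fderiv ℝ (fderiv ℝ f) q u v) p u' =
      fderiv ℝ (fderiv ℝ (fderiv ℝ f)) p u' u v := by
    rw [fderiv_clm_apply (hDD.clm_apply (differentiableAt_const u)) (differentiableAt_const v),
      fderiv_clm_apply hDD (differentiableAt_const u)]
    simp
  have hgf : DifferentiableAt ℝ (fun q => g (f q)) p := hg1.comp p hf1
  have hgf' : fderiv ℝ (fun q => g (f q)) p u' = fderiv ℝ g p u' := by
    rw [fderiv_fun_comp p hg1 hf1, hDf, hfp]
    rfl
  have hDgf : DifferentiableAt ℝ (fun q => fderiv ℝ g (f q)) p := hDg.comp p hf1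
  have hDgfu : DifferentiableAt ℝ (fun q => fderiv ℝ g (f q) (fderiv ℝ f q u)) p :=
    hDgf.clm_apply (hDv u)
  have hDgfu' : fderiv ℝ (fun q => fderiv ℝ g (f q) (fderiv ℝ f q u)) p u' =
      fderiv ℝ (fderiv ℝ g) p u' u + fderiv ℝ g p (fderiv ℝ (fderiv ℝ f) p u' u) := by
    rw [fderiv_clm_apply hDgf (hDv u), fderiv_fun_comp p hDg hf1]
    simp [hDv', hDf, hfp, add_comm]
  have hev : (fun q => fderiv ℝ
        (fun r => g (f r) (fderiv ℝ f r v) (fderiv ℝ f r w)) q u) =ᶠ[nhds p] fun q =>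
      fderiv ℝ g (f q) (fderiv ℝ f q u) (fderiv ℝ f q v) (fderiv ℝ f q w)
        + g (f q) (fderiv ℝ (fderiv ℝ f) q u v) (fderiv ℝ f q w)
        + g (f q) (fderiv ℝ f q v) (fderiv ℝ (fderiv ℝ f) q u w) := by
    filter_upwards [hf.eventually (by simp),
      hf1.continuousAt.eventually (hgp.eventually (by simp))] with q hfq hgq
    exact fderiv_pullback_apply (hgq.differentiableAt (by simp)) (hfq.of_le (by norm_num)) u v w
  have h1 := hDgfu.clm_apply (hDv v) |>.clm_apply (hDv w)
  have h2 := hgf.clm_apply (hDDv v) |>.clm_apply (hDv w)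
  have h3 := hgf.clm_apply (hDv v) |>.clm_apply (hDDv w)
  rw [hev.fderiv_eq, fderiv_fun_add (h1.fun_add h2) h3, fderiv_fun_add h1 h2,
    add_apply, add_apply,
    fderiv_bilin_apply hDgfu (hDv v) (hDv w),
    fderiv_bilin_apply (G := fun q => g (f q)) hgf (hDDv v) (hDv w),
    fderiv_bilin_apply (G := fun q => g (f q)) hgf (hDv v) (hDDv w),
    hDgfu', hgf', hDv', hDv', hDDv', hDDv', hDf, hfp]
  simp only [add_apply, ContinuousLinearMap.id_apply]
  ring

end PullbackJets

theorem fderiv_fderiv_fderiv_symm_left {E F : Type*} [NormedAddCommGroup E] [NormedSpace ℝ E]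
    [NormedAddCommGroup F] [NormedSpace ℝ F] {f : E → F} {p : E} (hf : ContDiffAt ℝ 3 f p)
    (x y z : E) :
    fderiv ℝ (fderiv ℝ (fderiv ℝ f)) p x y z = fderiv ℝ (fderiv ℝ (fderiv ℝ f)) p y x z := by
  have hDf : ContDiffAt ℝ 2 (fderiv ℝ f) p := hf.fderiv_right (by norm_num)
  exact congrArg (fun L => L z) (hDf.isSymmSndFDerivAt (by simp) x y)

theorem fderiv_fderiv_fderiv_symm_right {E F : Type*} [NormedAddCommGroup E] [NormedSpace ℝ E]
    [NormedAddCommGroup F] [NormedSpace ℝ F] {f : E → F} {p : E} (hf : ContDiffAt ℝ 3 f p)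
    (x y z : E) :
    fderiv ℝ (fderiv ℝ (fderiv ℝ f)) p x y z = fderiv ℝ (fderiv ℝ (fderiv ℝ f)) p x z y := by
  have hDf : ContDiffAt ℝ 2 (fderiv ℝ f) p := hf.fderiv_right (by norm_num)
  have hDD : DifferentiableAt ℝ (fderiv ℝ (fderiv ℝ f)) p :=
    (hDf.fderiv_right (m := 1) (by norm_num)).differentiableAt (by simp)
  have key (y z : E) : fderiv ℝ (fun q => fderiv ℝ (fderiv ℝ f) q y z) p x =
      fderiv ℝ (fderiv ℝ (fderiv ℝ f)) p x y z := by
    rw [fderiv_clm_apply (hDD.clm_apply (differentiableAt_const y)) (differentiableAt_const z),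
      fderiv_clm_apply hDD (differentiableAt_const y)]
    simp
  have hev : (fun q => fderiv ℝ (fderiv ℝ f) q y z) =ᶠ[nhds p]
      fun q => fderiv ℝ (fderiv ℝ f) q z y := by
    filter_upwards [hf.eventually (by simp)] with q hq
    exact (hq.of_le (by norm_num : (2 : WithTop ℕ∞) ≤ 3)).isSymmSndFDerivAt (by simp) y z
  rw [← key y z, ← key z y, hev.fderiv_eq]

/-- A trilinear-type expression symmetric in its first two arguments and antisymmetric in its last
two vanishes. -/
theorem eq_zero_of_symm_of_antisymm {V : Type*} {T : V → V → V → ℝ}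
    (hsymm : ∀ x y z, T x y z = T y x z) (hanti : ∀ x y z, T x y z + T x z y = 0) (x y z : V) :
    T x y z = 0 := by
  linarith [hsymm x y z, hanti y x z, hsymm y z x, hanti z y x, hsymm z x y, hanti x z y]

end

/-- **Generic lightlike metrics are `(3,1)`-sub-rigid** (Theorem 1 of the paper).
Let `g` be a smooth lightlike metric on a neighborhood `U` of `0` in `ℝⁿ`, `n ≥ 4`:
each `g_p` is positive semidefinite and symmetric with one-dimensional kernel spanned by
a nonvanishing smooth vector field `X`.  Assume `g` is generic: the kernel of the Lie
derivative `(L_X g)_p(v,w) = (Dg_p(X_p))(v,w) + g_p((DX_p)v, w) + g_p(v, (DX_p)w)` is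
exactly the line `ℝ·X_p`.  If `f` is a `3`-infinitesimal isometry of `g` at `0`
(`f(0) = 0` and `p ↦ (f*g)_p − g_p` vanishes to order `2` at `0`) with `Df(0) = id`,
then `D²f(0) = 0`. -/
theorem generic_lightlike_is_three_one_subrigid
    (n : ℕ) (hn : 4 ≤ n)
    (U : Set (Fin n → ℝ)) (hU : IsOpen U) (hU0 : (0 : Fin n → ℝ) ∈ U)
    (g : (Fin n → ℝ) → ((Fin n → ℝ) →L[ℝ] (Fin n → ℝ) →L[ℝ] ℝ))
    (hg : ContDiffOn ℝ (⊤ : ℕ∞) g U)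
    (hsym : ∀ p ∈ U, ∀ v w : Fin n → ℝ, g p v w = g p w v)
    (hpos : ∀ p ∈ U, ∀ v : Fin n → ℝ, 0 ≤ g p v v)
    (X : (Fin n → ℝ) → (Fin n → ℝ)) (hX : ContDiffOn ℝ (⊤ : ℕ∞) X U)
    (hXne : ∀ p ∈ U, X p ≠ 0)
    (hker : ∀ p ∈ U, ∀ v : Fin n → ℝ,
      (∀ w : Fin n → ℝ, g p v w = 0) ↔ ∃ t : ℝ, v = t • X p)
    (hgeneric : ∀ p ∈ U, ∀ v : Fin n → ℝ,
      (∀ w : Fin n → ℝ,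
        fderiv ℝ g p (X p) v w + g p (fderiv ℝ X p v) w + g p v (fderiv ℝ X p w) = 0)
        ↔ ∃ t : ℝ, v = t • X p)
    (f : (Fin n → ℝ) → (Fin n → ℝ)) (hf : ContDiffOn ℝ (⊤ : ℕ∞) f U) (hf0 : f 0 = 0)
    (hiso : VanishesToOrderAtZero
      (fun p => pullbackBilin (g (f p)) (fderiv ℝ f p) - g p) 2)
    (hjet1 : fderiv ℝ f 0 = ContinuousLinearMap.id ℝ (Fin n → ℝ)) :
    iteratedFDeriv ℝ 2 f 0 = 0 := by
  set_option maxSynthPendingDepth 3 in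
  have hUn : U ∈ nhds (0 : Fin n → ℝ) := hU.mem_nhds hU0
  have hle (k : ℕ) : (k : WithTop ℕ∞) ≤ ((⊤ : ℕ∞) : WithTop ℕ∞) := by
    exact_mod_cast (le_top : (k : ℕ∞) ≤ ⊤)
  have hf3 : ContDiffAt ℝ 3 f 0 := (hf.contDiffAt hUn).of_le (hle 3)
  have hf2 : ContDiffAt ℝ 2 f 0 := hf3.of_le (by norm_num)
  have hg2 : ContDiffAt ℝ 2 g 0 := (hg.contDiffAt hUn).of_le (hle 2)
  have hg1 : DifferentiableAt ℝ g 0 := hg2.differentiableAt (by simp)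
  have hX1 : DifferentiableAt ℝ X 0 := (hX.contDiffAt hUn).differentiableAt (by simp)
  have hgX : ∀ p ∈ U, ∀ w, g p (X p) w = 0 := fun p hp => (hker p hp (X p)).2 ⟨1, by simp⟩
  have hgX0 := hgX 0 hU0
  have hDsym (u v w) : fderiv ℝ g 0 u v w = fderiv ℝ g 0 u w v := by
    have hev : (fun q => g q v w) =ᶠ[nhds 0] fun q => g q w v := by
      filter_upwards [hUn] with q hq using hsym q hq v w
    rw [← fderiv_apply_apply hg1, ← fderiv_apply_apply hg1, hev.fderiv_eq]
  have hDgX (u w) : fderiv ℝ g 0 u (X 0) w = -g 0 (fderiv ℝ X 0 u) w := by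
    have hev : (fun q => g q (X q) w) =ᶠ[nhds 0] fun _ => 0 := by
      filter_upwards [hUn] with q hq using hgX q hq w
    have := fderiv_bilin_apply hg1 hX1 (differentiableAt_const w) u
    rw [hev.fderiv_eq] at this
    simp only [fderiv_fun_const, Pi.zero_apply, zero_apply, map_zero,
      add_zero] at this
    linarith
  -- `H = f^* g` and `g` have the same second order jet at `0`.
  set H : (Fin n → ℝ) → (Fin n → ℝ) →L[ℝ] (Fin n → ℝ) →L[ℝ] ℝ :=
    fun p => pullbackBilin (g (f p)) (fderiv ℝ f p)
  have hH2 : ContDiffAt ℝ 2 H 0 := by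
    have hDf2 : ContDiffAt ℝ 2 (fderiv ℝ f) 0 := hf3.fderiv_right (by norm_num)
    have hgf2 : ContDiffAt ℝ 2 (fun p => g (f p)) 0 :=
      ContDiffAt.comp (g := g) 0 (by rwa [hf0]) hf2
    have hflip {B : (Fin n → ℝ) → (Fin n → ℝ) →L[ℝ] (Fin n → ℝ) →L[ℝ] ℝ}
        (hB : ContDiffAt ℝ 2 B 0) : ContDiffAt ℝ 2 (fun p => (B p).flip) 0 :=
      (ContinuousLinearMap.flipₗᵢ ℝ (Fin n → ℝ) (Fin n → ℝ) ℝ).contDiff.contDiffAt.comp 0 hB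
    exact hflip ((hflip (hgf2.clm_comp hDf2)).clm_comp hDf2)
  have hHjet (j : ℕ) (hj : j ≤ 2) : iteratedFDeriv ℝ j H 0 = iteratedFDeriv ℝ j g 0 := by
    have hj' : (j : WithTop ℕ∞) ≤ 2 := by exact_mod_cast hj
    rw [← sub_eq_zero, ← iteratedFDeriv_sub_apply (hH2.of_le hj') (hg2.of_le hj')]
    exact hiso j hj
  have hH1 : fderiv ℝ H 0 = fderiv ℝ g 0 := by
    ext1 u
    simpa using congrArg (fun L => L ![u]) (hHjet 1 one_le_two)
  have hHH (u' u : Fin n → ℝ) :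
      fderiv ℝ (fderiv ℝ H) 0 u' u = fderiv ℝ (fderiv ℝ g) 0 u' u := by
    simpa [iteratedFDeriv_two_apply] using congrArg (fun L => L ![u', u]) (hHjet 2 le_rfl)
  have hfirst (u v w) : g 0 (fderiv ℝ (fderiv ℝ f) 0 u v) w
      + g 0 (fderiv ℝ (fderiv ℝ f) 0 u w) v = 0 := by
    have h1 : fderiv ℝ (fun q => g (f q) (fderiv ℝ f q v) (fderiv ℝ f q w)) 0 u = _ :=
      fderiv_apply_apply (hH2.differentiableAt (by simp)) u v w
    rw [hH1, fderiv_pullback_apply (by rwa [hf0]) hf2, hf0, hjet1] at h1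
    simp only [ContinuousLinearMap.id_apply] at h1
    rw [hsym 0 hU0 v] at h1
    linarith
  have hsnd (u v) : fderiv ℝ (fderiv ℝ f) 0 u v = fderiv ℝ (fderiv ℝ f) 0 v u :=
    hf2.isSymmSndFDerivAt (by simp) u v
  have hgD : ∀ u v w, g 0 (fderiv ℝ (fderiv ℝ f) 0 u v) w = 0 :=
    eq_zero_of_symm_of_antisymm (fun u v w => by rw [hsnd]) hfirst
  -- Hence `D²f = b ⊗ X` at `0`.
  obtain ⟨l, hl⟩ := SeparatingDual.exists_eq_one (R := ℝ) (hXne 0 hU0)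
  have hb (u v) : fderiv ℝ (fderiv ℝ f) 0 u v = l (fderiv ℝ (fderiv ℝ f) 0 u v) • X 0 := by
    obtain ⟨t, ht⟩ := (hker 0 hU0 _).1 (hgD u v)
    rw [ht]
    simp [hl]
  let b : LinearMap.BilinForm ℝ (Fin n → ℝ) :=
    LinearMap.mk₂ ℝ (fun u v => l (fderiv ℝ (fderiv ℝ f) 0 u v))
      (by simp) (by simp) (by simp) (by simp)
  let h : LinearMap.BilinForm ℝ (Fin n → ℝ) :=
    LinearMap.mk₂ ℝ (fun v w =>
      fderiv ℝ g 0 (X 0) v w + g 0 (fderiv ℝ X 0 v) w + g 0 v (fderiv ℝ X 0 w))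
      (by intros; simp; ring) (by intros; simp; ring)
      (by intros; simp; ring) (by intros; simp; ring)
  have hb' (u v) : fderiv ℝ (fderiv ℝ f) 0 u v = b u v • X 0 := hb u v
  have hbsymm (u v) : b u v = b v u := congrArg l (hsnd u v)
  have hh (v w) : h v w =
      fderiv ℝ g 0 (X 0) v w + g 0 (fderiv ℝ X 0 v) w + g 0 v (fderiv ℝ X 0 w) := rfl
  have hhsymm : h.IsSymm := ⟨fun v w => by
    rw [hh, hh, hDsym, hsym 0 hU0 v, hsym 0 hU0 w]
    ring⟩
  let S (x y z w : Fin n → ℝ) : ℝ := g 0 (fderiv ℝ (fderiv ℝ (fderiv ℝ f)) 0 x y z) w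
    - (b x y * g 0 (fderiv ℝ X 0 z) w + b x z * g 0 (fderiv ℝ X 0 y) w
      + b y z * g 0 (fderiv ℝ X 0 x) w)
  have hS12 (x y z w) : S x y z w = S y x z w := by
    simp only [S]
    rw [fderiv_fderiv_fderiv_symm_left hf3, hbsymm x y]
    ring
  have hS23 (x y z w) : S x y z w = S x z y w := by
    simp only [S]
    rw [fderiv_fderiv_fderiv_symm_right hf3, hbsymm y z]
    ring
  have hsecond (x y z w) : b x y * h z w = -(S x y z w + S x y w z) := by
    have h1 : fderiv ℝ (fun q => fderiv ℝ
        (fun r => g (f r) (fderiv ℝ f r z) (fderiv ℝ f r w)) q y) 0 x = _ :=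
      fderiv_fderiv_apply_apply hH2 y x z w
    rw [hHH, fderiv_fderiv_pullback_apply hg2 hf3 hf0 hjet1] at h1
    simp only [hb', map_smul, smul_apply, smul_eq_mul, hgX0,
      hDsym _ z (X 0), hDgX] at h1
    rw [hsym 0 hU0 z] at h1
    simp only [S]
    rw [hh, hsym 0 hU0 z]
    linear_combination h1
  have hb0 : b = 0 := by
    refine eq_zero_of_kulkarniNomizu_eq_zero (by simpa using hn) hhsymm
      (fun v hv => (hgeneric 0 hU0 v).1 hv) fun x y z w => ?_
    have hS13 (x y z w) : S x y z w = S z y x w := by rw [hS12, hS23, hS12]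
    linear_combination hsecond x z y w + hsecond y w x z - hsecond x w y z - hsecond y z x w
      - hS13 x z y w - hS23 x z w y + hS13 x w y z + hS23 y z w x
  ext1 m
  rw [iteratedFDeriv_two_apply, hb', hb0]
  simp
end

section
/- Let d ≥ 1, n = 2d+1, and let U ⊆ ℝⁿ be an open neighborhood of 0. Let ω : U → (ℝⁿ)* be a smooth nonvanishing family of linear forms, and for p ∈ U define the alternating bilinear form dω_p(v,w) = (Dω_p(v))(w) − (Dω_p(w))(v). Assume ω is contact: for every p ∈ U the restriction of dω_p to the hyperplane ker ω_p is nondegenerate. Let h : U → Sym²(ℝⁿ)* be a smooth family of symmetric bilinear forms whose restriction to ker ω_p is positive definite for every p. Let f : U → ℝⁿ be smooth with f(0) = 0, and suppose f is a 4-infinitesimal isometry of the contact sub-Riemannian structure (ker ω, h) at 0, meaning: there exist a smooth function a : U → ℝ and a smooth map β : U → (ℝⁿ)* such that the map p ↦ (f*ω)_p − a(p)·ω_p vanishes to order 3 at 0, and the map p ↦ (f*h)_p − h_p − (ω_p ⊗ β_p + β_p ⊗ ω_p) vanishes to order 3 at 0. If Df(0) = id, then D²f(0) = 0. (Contact sub-Riemannian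 metrics are (4,1)-sub-rigid.) -/
/-- Two maps, both smooth at `0`, have the same `2`-jet at `0`. -/
structure SameTwoJet {E F : Type*} [NormedAddCommGroup E] [NormedSpace ℝ E]
    [NormedAddCommGroup F] [NormedSpace ℝ F] (A B : E → F) : Prop where
  left : ContDiffAt ℝ (⊤ : ℕ∞) A 0
  right : ContDiffAt ℝ (⊤ : ℕ∞) B 0
  value : A 0 = B 0
  first : fderiv ℝ A 0 = fderiv ℝ B 0
  second : fderiv ℝ (fderiv ℝ A) 0 = fderiv ℝ (fderiv ℝ B) 0

theorem ContDiffAt.fderiv_top {E F : Type*} [NormedAddCommGroup E] [NormedSpace ℝ E]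
    [NormedAddCommGroup F] [NormedSpace ℝ F] {A : E → F} {x : E}
    (hA : ContDiffAt ℝ (⊤ : ℕ∞) A x) : ContDiffAt ℝ (⊤ : ℕ∞) (fderiv ℝ A) x :=
  hA.fderiv_right (by norm_cast)

theorem ContDiffAt.differentiableAt_top {E F : Type*} [NormedAddCommGroup E] [NormedSpace ℝ E]
    [NormedAddCommGroup F] [NormedSpace ℝ F] {A : E → F} {x : E}
    (hA : ContDiffAt ℝ (⊤ : ℕ∞) A x) : DifferentiableAt ℝ A x :=
  hA.differentiableAt (by simp)

theorem ContDiffAt.eventually_differentiableAt {E F : Type*} [NormedAddCommGroup E]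
    [NormedSpace ℝ E] [NormedAddCommGroup F] [NormedSpace ℝ F] {A : E → F} {x : E}
    (hA : ContDiffAt ℝ (⊤ : ℕ∞) A x) : ∀ᶠ p in nhds x, DifferentiableAt ℝ A p :=
  ((hA.of_le (m := 1) (by norm_cast)).eventually (by simp)).mono
    fun _ hp => hp.differentiableAt (by simp)

namespace SameTwoJet

variable {E F : Type*} [NormedAddCommGroup E] [NormedSpace ℝ E]
  [NormedAddCommGroup F] [NormedSpace ℝ F]

theorem refl {A : E → F} (hA : ContDiffAt ℝ (⊤ : ℕ∞) A 0) : SameTwoJet A A :=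
  ⟨hA, hA, rfl, rfl, rfl⟩

theorem symm {A B : E → F} (h : SameTwoJet A B) : SameTwoJet B A :=
  ⟨h.right, h.left, h.value.symm, h.first.symm, h.second.symm⟩

theorem trans {A B C : E → F} (h : SameTwoJet A B) (h' : SameTwoJet B C) : SameTwoJet A C :=
  ⟨h.left, h'.right, h.value.trans h'.value, h.first.trans h'.first, h.second.trans h'.second⟩

theorem of_eventuallyEq {A B : E → F} (hA : ContDiffAt ℝ (⊤ : ℕ∞) A 0)
    (h : A =ᶠ[nhds 0] B) : SameTwoJet A B :=
  ⟨hA, hA.congr_of_eventuallyEq h.symm, h.eq_of_nhds, h.fderiv_eq, h.fderiv.fderiv_eq⟩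

theorem add {A B A' B' : E → F} (h : SameTwoJet A B) (h' : SameTwoJet A' B') :
    SameTwoJet (fun p => A p + A' p) (fun p => B p + B' p) := by
  have key : ∀ {C D : E → F}, ContDiffAt ℝ (⊤ : ℕ∞) C 0 → ContDiffAt ℝ (⊤ : ℕ∞) D 0 →
      fderiv ℝ (fun p => C p + D p) =ᶠ[nhds 0] fun p => fderiv ℝ C p + fderiv ℝ D p := by
    intro C D hC hD
    filter_upwards [hC.eventually_differentiableAt, hD.eventually_differentiableAt] with p hp hp'
    exact fderiv_fun_add hp hp'
  refine ⟨h.left.add h'.left, h.right.add h'.right, by simp [h.value, h'.value], ?_, ?_⟩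
  · rw [(key h.left h'.left).eq_of_nhds, (key h.right h'.right).eq_of_nhds, h.first, h'.first]
  · rw [(key h.left h'.left).fderiv_eq, (key h.right h'.right).fderiv_eq,
      fderiv_fun_add h.left.fderiv_top.differentiableAt_top h'.left.fderiv_top.differentiableAt_top,
      fderiv_fun_add h.right.fderiv_top.differentiableAt_top
        h'.right.fderiv_top.differentiableAt_top, h.second, h'.second]

theorem mul {A B A' B' : E → ℝ} (h : SameTwoJet A B) (h' : SameTwoJet A' B') :
    SameTwoJet (fun p => A p * A' p) (fun p => B p * B' p) := by
  have key : ∀ {C D : E → ℝ}, ContDiffAt ℝ (⊤ : ℕ∞) C 0 → ContDiffAt ℝ (⊤ : ℕ∞) D 0 →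
      fderiv ℝ (fun p => C p * D p) =ᶠ[nhds 0]
        fun p => C p • fderiv ℝ D p + D p • fderiv ℝ C p := by
    intro C D hC hD
    filter_upwards [hC.eventually_differentiableAt, hD.eventually_differentiableAt] with p hp hp'
    exact fderiv_fun_mul hp hp'
  have key' : ∀ {C D : E → ℝ}, ContDiffAt ℝ (⊤ : ℕ∞) C 0 → ContDiffAt ℝ (⊤ : ℕ∞) D 0 →
      fderiv ℝ (fderiv ℝ (fun p => C p * D p)) 0 =
        C 0 • fderiv ℝ (fderiv ℝ D) 0 + (fderiv ℝ C 0).smulRight (fderiv ℝ D 0) +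
        (D 0 • fderiv ℝ (fderiv ℝ C) 0 + (fderiv ℝ D 0).smulRight (fderiv ℝ C 0)) := by
    intro C D hC hD
    have hC' := hC.fderiv_top.differentiableAt_top
    have hD' := hD.fderiv_top.differentiableAt_top
    have hC0 := hC.differentiableAt_top
    have hD0 := hD.differentiableAt_top
    rw [(key hC hD).fderiv_eq, fderiv_fun_add (hC0.fun_smul hD') (hD0.fun_smul hC'),
      fderiv_fun_smul hC0 hD', fderiv_fun_smul hD0 hC']
  refine ⟨h.left.mul h'.left, h.right.mul h'.right, by simp [h.value, h'.value], ?_, ?_⟩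
  · rw [(key h.left h'.left).eq_of_nhds, (key h.right h'.right).eq_of_nhds, h.first, h'.first,
      h.value, h'.value]
  · rw [key' h.left h'.left, key' h.right h'.right, h.first, h'.first, h.value, h'.value,
      h.second, h'.second]

theorem const_mul (c : ℝ) {A B : E → ℝ} (h : SameTwoJet A B) :
    SameTwoJet (fun p => c * A p) (fun p => c * B p) :=
  (refl (A := fun _ => c) contDiffAt_const).mul h

theorem sum {ι : Type*} (s : Finset ι) {A B : ι → E → ℝ} (h : ∀ i, SameTwoJet (A i) (B i)) :
    SameTwoJet (fun p => ∑ i ∈ s, A i p) (fun p => ∑ i ∈ s, B i p) := by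
  classical
  induction s using Finset.induction_on with
  | empty => simpa using refl contDiffAt_const
  | insert i s hi ih =>
    simp only [Finset.sum_insert hi]
    exact (h i).add ih

theorem prod {ι : Type*} (s : Finset ι) {A B : ι → E → ℝ} (h : ∀ i, SameTwoJet (A i) (B i)) :
    SameTwoJet (fun p => ∏ i ∈ s, A i p) (fun p => ∏ i ∈ s, B i p) := by
  classical
  induction s using Finset.induction_on with
  | empty => simpa using refl contDiffAt_const
  | insert i s hi ih =>
    simp only [Finset.prod_insert hi]
    exact (h i).mul ih

theorem det {ι : Type*} [Fintype ι] [DecidableEq ι] {A B : E → Matrix ι ι ℝ}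
    (h : ∀ i j, SameTwoJet (fun p => A p i j) (fun p => B p i j)) :
    SameTwoJet (fun p => (A p).det) (fun p => (B p).det) := by
  simp only [Matrix.det_apply']
  exact sum _ fun σ => const_mul _ (prod _ fun i => h _ _)

theorem of_eventuallyEq_add {G A B : E → F} (hG : SameTwoJet G fun _ => 0)
    (hB : ContDiffAt ℝ (⊤ : ℕ∞) B 0) (h : ∀ᶠ p in nhds 0, A p = G p + B p) :
    SameTwoJet A B := by
  have hGB := hG.add (refl hB)
  simp only [zero_add] at hGB
  exact (of_eventuallyEq hGB.left (h.mono fun _ hp => hp.symm)).symm.trans hGB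

theorem clm {F' : Type*} [NormedAddCommGroup F'] [NormedSpace ℝ F'] (L : F →L[ℝ] F')
    {A B : E → F} (h : SameTwoJet A B) : SameTwoJet (fun p => L (A p)) (fun p => L (B p)) := by
  have key : ∀ {C : E → F}, ContDiffAt ℝ (⊤ : ℕ∞) C 0 →
      fderiv ℝ (fun p => L (C p)) =ᶠ[nhds 0] fun p => L ∘L fderiv ℝ C p := by
    intro C hC
    filter_upwards [hC.eventually_differentiableAt] with p hp
    exact (L.hasFDerivAt.comp p hp.hasFDerivAt).fderiv
  have key' : ∀ {C : E → F}, ContDiffAt ℝ (⊤ : ℕ∞) C 0 →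
      fderiv ℝ (fderiv ℝ (fun p => L (C p))) 0 =
        (ContinuousLinearMap.compL ℝ E F F' L) ∘L fderiv ℝ (fderiv ℝ C) 0 := by
    intro C hC
    rw [(key hC).fderiv_eq]
    exact ((ContinuousLinearMap.compL ℝ E F F' L).hasFDerivAt.comp 0
      hC.fderiv_top.differentiableAt_top.hasFDerivAt).fderiv
  refine ⟨L.contDiff.contDiffAt.comp 0 h.left, L.contDiff.contDiffAt.comp 0 h.right,
    by rw [h.value], ?_, ?_⟩
  · rw [(key h.left).eq_of_nhds, (key h.right).eq_of_nhds, h.first]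
  · rw [key' h.left, key' h.right, h.second]

/-- If `ψ ∘ f` and `a ^ k * ψ` have the same `2`-jet, where `f` is tangent to the identity, then
the first two derivatives of `a` are determined by the second derivative of `f`. -/
theorem conformal_factor {k : ℕ} (hk : k ≠ 0) {ψ a : E → ℝ} {f : E → E}
    (hψ : ContDiffAt ℝ (⊤ : ℕ∞) ψ 0) (ha : ContDiffAt ℝ (⊤ : ℕ∞) a 0)
    (hf : ContDiffAt ℝ (⊤ : ℕ∞) f 0) (hf0 : f 0 = 0) (hf1 : fderiv ℝ f 0 = .id ℝ E)
    (hψ0 : ψ 0 ≠ 0) (ha0 : a 0 = 1)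
    (h : SameTwoJet (fun p => ψ (f p)) (fun p => a p ^ k * ψ p)) :
    fderiv ℝ a 0 = 0 ∧ ∃ θ : E →L[ℝ] ℝ, ∀ u v,
      fderiv ℝ (fderiv ℝ a) 0 u v = θ (fderiv ℝ (fderiv ℝ f) 0 u v) := by
  have hψf : ContDiffAt ℝ (⊤ : ℕ∞) ψ (f 0) := by rwa [hf0]
  have hk' : (k : ℝ) ≠ 0 := Nat.cast_ne_zero.2 hk
  have hl : fderiv ℝ (fun p => ψ (f p)) =ᶠ[nhds 0]
      fun p => (fderiv ℝ ψ (f p)).comp (fderiv ℝ f p) := by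
    filter_upwards [hf.eventually_differentiableAt,
      hf.continuousAt.eventually hψf.eventually_differentiableAt] with p hp hp'
    exact (hp'.hasFDerivAt.comp p hp.hasFDerivAt).fderiv
  have hr : fderiv ℝ (fun p => a p ^ k * ψ p) =ᶠ[nhds 0]
      fun p => a p ^ k • fderiv ℝ ψ p + (ψ p * (k * a p ^ (k - 1))) • fderiv ℝ a p := by
    filter_upwards [ha.eventually_differentiableAt, hψ.eventually_differentiableAt] with p hp hp'
    rw [fderiv_fun_mul (hp.fun_pow k) hp', fderiv_fun_pow k hp]
    simp [smul_smul, nsmul_eq_mul]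
  have h1 : fderiv ℝ a 0 = 0 := by
    have := h.first
    rw [hl.eq_of_nhds, hr.eq_of_nhds, hf0, hf1, ha0] at this
    simpa [hk, hψ0] using this
  refine ⟨h1, ((k : ℝ) * ψ 0)⁻¹ • fderiv ℝ ψ 0, fun u v => ?_⟩
  have h2 := h.second
  have hψ' : HasFDerivAt (fun p => fderiv ℝ ψ (f p)) (fderiv ℝ (fderiv ℝ ψ) 0) 0 := by
    have := hψf.fderiv_top.differentiableAt_top.hasFDerivAt.comp 0
      hf.differentiableAt_top.hasFDerivAt
    rw [hf1, hf0] at this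
    exact this
  have hda := ha.differentiableAt_top
  have hdψ := hψ.differentiableAt_top
  have hda' := ha.fderiv_top.differentiableAt_top
  have hdψ' := hψ.fderiv_top.differentiableAt_top
  have hc : DifferentiableAt ℝ (fun p => ψ p * (k * a p ^ (k - 1))) 0 := by fun_prop
  rw [hl.fderiv_eq, hr.fderiv_eq,
    (hψ'.clm_comp hf.fderiv_top.differentiableAt_top.hasFDerivAt).fderiv,
    fderiv_fun_add ((hda.fun_pow k).fun_smul hdψ') (hc.fun_smul hda'),
    fderiv_fun_smul (hda.fun_pow k) hdψ', fderiv_fun_smul hc hda', fderiv_fun_pow k hda] at h2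
  have h3 := congrArg (fun T => T u v) h2
  simp [hf0, hf1, h1, ha0] at h3
  change _ = ((k : ℝ) * ψ 0)⁻¹ * fderiv ℝ ψ 0 (fderiv ℝ (fderiv ℝ f) 0 u v)
  field_simp
  linarith

end SameTwoJet

/-- The matrix `K` bordered by the column `w`, the row `ε • w` and a zero corner. -/
def borderedMatrix {ι : Type*} (ε : ℝ) (K : Matrix ι ι ℝ) (w : ι → ℝ) :
    Matrix (ι ⊕ Unit) (ι ⊕ Unit) ℝ :=
  Matrix.fromBlocks K (Matrix.replicateCol Unit w) (Matrix.replicateRow Unit (ε • w)) 0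

section BorderedMatrix

variable {ι : Type*} [Fintype ι] [DecidableEq ι]

theorem det_borderedMatrix_congr (ε : ℝ) (K P : Matrix ι ι ℝ) (w : ι → ℝ) :
    (borderedMatrix ε (P.transpose * K * P) (Matrix.vecMul w P)).det =
      P.det ^ 2 * (borderedMatrix ε K w).det := by
  have : borderedMatrix ε (P.transpose * K * P) (Matrix.vecMul w P) =
      (Matrix.fromBlocks P 0 0 (1 : Matrix Unit Unit ℝ)).transpose * borderedMatrix ε K w *
        Matrix.fromBlocks P 0 0 (1 : Matrix Unit Unit ℝ) := by
    simp only [borderedMatrix, Matrix.fromBlocks_transpose, Matrix.fromBlocks_multiply]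
    congr 1
    · simp
    · ext i j
      simp [Matrix.mul_apply, Matrix.vecMul, dotProduct, mul_comm]
    · ext i j
      simp [Matrix.mul_apply, Matrix.vecMul, dotProduct, Finset.mul_sum]
    · simp
  rw [this, Matrix.det_mul, Matrix.det_mul, Matrix.det_transpose, Matrix.det_fromBlocks_zero₁₂,
    Matrix.det_one]
  ring

theorem det_borderedMatrix_add (ε : ℝ) (K : Matrix ι ι ℝ) (w l : ι → ℝ) :
    (borderedMatrix ε (K + Matrix.vecMulVec w l + ε • Matrix.vecMulVec l w) w).det =
      (borderedMatrix ε K w).det := by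
  have : borderedMatrix ε (K + Matrix.vecMulVec w l + ε • Matrix.vecMulVec l w) w =
      (Matrix.fromBlocks (1 : Matrix ι ι ℝ) 0 (Matrix.replicateRow Unit l)
        (1 : Matrix Unit Unit ℝ)).transpose * borderedMatrix ε K w *
      Matrix.fromBlocks (1 : Matrix ι ι ℝ) 0 (Matrix.replicateRow Unit l)
        (1 : Matrix Unit Unit ℝ) := by
    simp only [borderedMatrix, Matrix.fromBlocks_transpose, Matrix.fromBlocks_multiply]
    congr 1
    · ext i j
      simp [Matrix.mul_apply, Matrix.vecMulVec]
      ring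
    · ext i j
      simp
    · ext i j
      simp
    · ext i j
      simp
  rw [this, Matrix.det_mul, Matrix.det_mul, Matrix.det_transpose, Matrix.det_fromBlocks_zero₁₂,
    Matrix.det_one, Matrix.det_one]
  ring

theorem det_borderedMatrix_smul (ε a : ℝ) (K : Matrix ι ι ℝ) (w : ι → ℝ) :
    (borderedMatrix ε K (a • w)).det = a ^ 2 * (borderedMatrix ε K w).det := by
  have : borderedMatrix ε K (a • w) =
      Matrix.fromBlocks (1 : Matrix ι ι ℝ) 0 0 (a • (1 : Matrix Unit Unit ℝ)) *
        borderedMatrix ε K w *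
      Matrix.fromBlocks (1 : Matrix ι ι ℝ) 0 0 (a • (1 : Matrix Unit Unit ℝ)) := by
    simp only [borderedMatrix, Matrix.fromBlocks_multiply]
    congr 1
    · simp
    · ext i j
      simp
    · ext i j
      simp
    · simp
  rw [this, Matrix.det_mul, Matrix.det_mul, Matrix.det_fromBlocks_zero₁₂]
  simp
  ring

theorem det_borderedMatrix_smul_smul (ε a : ℝ) (K : Matrix ι ι ℝ) (w : ι → ℝ) :
    (borderedMatrix ε (a • K) (a • w)).det =
      a ^ (Fintype.card ι + 1) * (borderedMatrix ε K w).det := by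
  have : borderedMatrix ε (a • K) (a • w) = a • borderedMatrix ε K w := by
    simp only [borderedMatrix, Matrix.fromBlocks_smul]
    congr 1
    · ext i j
      simp
      ring
    · simp
  rw [this, Matrix.det_smul]
  simp

/-- A bordered matrix is invertible if the bilinear form is nondegenerate on the kernel of the
border. -/
theorem det_borderedMatrix_ne_zero (ε : ℝ) (K : Matrix ι ι ℝ) (w : ι → ℝ) (hε : ε ≠ 0)
    (hw : w ≠ 0)
    (hK : ∀ x, dotProduct w x = 0 →
      (∀ y, dotProduct w y = 0 → dotProduct y (K.mulVec x) = 0) → x = 0) :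
    (borderedMatrix ε K w).det ≠ 0 := by
  intro hdet
  obtain ⟨v, hv, hv0⟩ := Matrix.exists_mulVec_eq_zero_iff.2 hdet
  have h1 : ∀ i, K.mulVec (fun j => v (Sum.inl j)) i + w i * v (Sum.inr ()) = 0 := by
    intro i
    have := congrFun hv0 (Sum.inl i)
    simpa [borderedMatrix, Matrix.mulVec, dotProduct] using this
  have h2 : dotProduct w (fun j => v (Sum.inl j)) = 0 := by
    have := congrFun hv0 (Sum.inr ())
    simp only [borderedMatrix, Matrix.mulVec, dotProduct, Fintype.sum_sum_type] at this
    simp [mul_assoc, ← Finset.mul_sum, hε] at this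
    exact this
  have hx := hK _ h2 fun y hy => by
    have : dotProduct y (K.mulVec fun j => v (Sum.inl j)) =
        - (v (Sum.inr ()) * dotProduct w y) := by
      simp only [dotProduct, Finset.mul_sum, ← Finset.sum_neg_distrib]
      refine Finset.sum_congr rfl fun i _ => ?_
      rw [eq_neg_of_add_eq_zero_left (h1 i)]
      ring
    rw [this, hy]
    simp
  obtain ⟨i, hi⟩ := Function.ne_iff.1 hw
  refine hv (funext fun j => ?_)
  rcases j with j | j
  · exact congrFun hx j
  · have := h1 i
    rw [hx] at this
    have h0 : K.mulVec (0 : ι → ℝ) i = 0 := by simp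
    rw [h0, zero_add] at this
    exact (mul_eq_zero.1 this).resolve_left hi

end BorderedMatrix

/-- The matrix of a bilinear form in the standard basis. -/
noncomputable def formMatrix {n : ℕ} (B : (Fin n → ℝ) →L[ℝ] (Fin n → ℝ) →L[ℝ] ℝ) :
    Matrix (Fin n) (Fin n) ℝ :=
  fun i j => B (Pi.single i 1) (Pi.single j 1)

/-- The coordinates of a linear form in the standard basis. -/
noncomputable def formVector {n : ℕ} (w : (Fin n → ℝ) →L[ℝ] ℝ) : Fin n → ℝ :=
  fun i => w (Pi.single i 1)

theorem formVector_dotProduct {n : ℕ} (w : (Fin n → ℝ) →L[ℝ] ℝ) (x : Fin n → ℝ) :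
    dotProduct (formVector w) x = w x := by
  conv_rhs => rw [pi_eq_sum_univ' x, map_sum]
  simp [dotProduct, formVector, mul_comm]

theorem formMatrix_dotProduct {n : ℕ} (B : (Fin n → ℝ) →L[ℝ] (Fin n → ℝ) →L[ℝ] ℝ)
    (x y : Fin n → ℝ) : dotProduct x ((formMatrix B).mulVec y) = B x y := by
  have h : (formMatrix B).mulVec y = formVector (B.flip y) := by
    ext i
    exact formVector_dotProduct (B (Pi.single i 1)) y
  rw [h, dotProduct_comm, formVector_dotProduct]
  rfl

/-- The matrix of a linear endomorphism in the standard basis. -/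
noncomputable def endMatrix {n : ℕ} (A : (Fin n → ℝ) →L[ℝ] (Fin n → ℝ)) :
    Matrix (Fin n) (Fin n) ℝ :=
  fun i j => A (Pi.single j 1) i

theorem formVector_vecMul_endMatrix {n : ℕ} (w : (Fin n → ℝ) →L[ℝ] ℝ)
    (A : (Fin n → ℝ) →L[ℝ] (Fin n → ℝ)) :
    Matrix.vecMul (formVector w) (endMatrix A) = fun i => w (A (Pi.single i 1)) := by
  ext i
  exact formVector_dotProduct w (A (Pi.single i 1))

theorem endMatrix_transpose_mul_formMatrix_mul {n : ℕ}
    (B : (Fin n → ℝ) →L[ℝ] (Fin n → ℝ) →L[ℝ] ℝ) (A : (Fin n → ℝ) →L[ℝ] (Fin n → ℝ)) :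
    (endMatrix A).transpose * formMatrix B * endMatrix A =
      fun i j => B (A (Pi.single i 1)) (A (Pi.single j 1)) := by
  ext i j
  rw [Matrix.mul_assoc]
  exact formMatrix_dotProduct B (A (Pi.single i 1)) (A (Pi.single j 1))

/-- A symmetric bilinear map that infinitesimally preserves a linear form `w`, a metric on `ker w`
and an alternating form which is nondegenerate on `ker w` is zero. -/
theorem contact_symmetric_bilinear_eq_zero {n : ℕ} (hn : Odd n) (w : (Fin n → ℝ) →L[ℝ] ℝ)
    (Θ H : (Fin n → ℝ) →L[ℝ] (Fin n → ℝ) →L[ℝ] ℝ)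
    (S : (Fin n → ℝ) →L[ℝ] (Fin n → ℝ) →L[ℝ] (Fin n → ℝ))
    (hskew : ∀ v x, Θ v x = -Θ x v)
    (hnd : ∀ v, w v = 0 → (∀ x, w x = 0 → Θ x v = 0) → v = 0)
    (hsym : ∀ v x, H v x = H x v) (hpos : ∀ v, w v = 0 → v ≠ 0 → 0 < H v v)
    (hS : ∀ u v, S u v = S v u) (hwS : ∀ u v, w (S u v) = 0)
    (hΘS : ∀ u v x, Θ (S u v) x + Θ v (S u x) = 0)
    (hHS : ∀ u v x, w u = 0 → w v = 0 → w x = 0 → H (S u v) x + H v (S u x) = 0) :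
    ∀ u v, S u v = 0 := by
  have hdet : (formMatrix Θ).det = 0 := by
    have h1 : (formMatrix Θ).transpose = -formMatrix Θ := by
      ext i j
      exact hskew _ _
    have h2 := Matrix.det_transpose (formMatrix Θ)
    rw [h1, Matrix.det_neg, Fintype.card_fin, hn.neg_one_pow] at h2
    linarith
  obtain ⟨R, hR, hR0⟩ := Matrix.exists_mulVec_eq_zero_iff.2 hdet
  have hΘR : ∀ v, Θ v R = 0 := fun v => by rw [← formMatrix_dotProduct, hR0, dotProduct_zero]
  have hwR : w R ≠ 0 := fun h => hR (hnd R h fun x _ => hΘR x)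
  have hSR : ∀ u, S u R = 0 := fun u => hnd _ (hwS u R) fun x _ => by
    have := hΘS u R x
    rw [hskew R, hΘR, neg_zero, add_zero] at this
    rw [hskew, this, neg_zero]
  have hker : ∀ u v, w u = 0 → w v = 0 → S u v = 0 := by
    intro u v hu hv
    by_contra hne
    have hx := hwS u v
    set x := S u v with hx_def
    have h1 := hHS u v x hu hv hx
    have h2 := hHS v u x hv hu hx
    have h3 := hHS x u v hx hu hv
    rw [hS v u, hS v x] at h2
    rw [hS u x] at h1
    rw [hsym (S x u) v] at h3
    have := hpos x hx hne
    rw [← hx_def] at h1 h2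
    linarith
  have hker' : ∀ u v, w v = 0 → S u v = 0 := by
    intro u v hv
    have h1 := hker (u - (w u / w R) • R) v (by simp [hwR]) hv
    have h2 : S R v = 0 := by rw [hS, hSR]
    simpa [h2] using h1
  intro u v
  have h1 := hker' u (v - (w v / w R) • R) (by simp [hwR])
  simpa [hSR] using h1

theorem SameTwoJet.flip_form {E F : Type*} [NormedAddCommGroup E] [NormedSpace ℝ E]
    [NormedAddCommGroup F] [NormedSpace ℝ F] {B C : F → (E →L[ℝ] E →L[ℝ] ℝ)}
    (h : SameTwoJet B C) : SameTwoJet (fun p => (B p).flip) (fun p => (C p).flip) :=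
  h.clm <| IsBoundedLinearMap.toContinuousLinearMap (f := fun T : E →L[ℝ] E →L[ℝ] ℝ => T.flip)
    ⟨⟨fun _ _ => rfl, fun _ _ => rfl⟩, 1, one_pos, fun T => by
      rw [one_mul]
      exact (ContinuousLinearMap.opNorm_flip T).le⟩

theorem ContDiffAt.flip_form {E F : Type*} [NormedAddCommGroup E] [NormedSpace ℝ E]
    [NormedAddCommGroup F] [NormedSpace ℝ F] {C : F → (E →L[ℝ] E →L[ℝ] ℝ)}
    (hC : ContDiffAt ℝ (⊤ : ℕ∞) C 0) : ContDiffAt ℝ (⊤ : ℕ∞) (fun p => (C p).flip) 0 :=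
  (SameTwoJet.refl hC).flip_form.left

section Pullback

variable {n : ℕ}

theorem pullbackBilin_apply (B : (Fin n → ℝ) →L[ℝ] (Fin n → ℝ) →L[ℝ] ℝ)
    (A : (Fin n → ℝ) →L[ℝ] (Fin n → ℝ)) (v w : Fin n → ℝ) :
    pullbackBilin B A v w = B (A v) (A w) :=
  rfl

theorem VanishesToOrderAtZero.sameTwoJet {F : Type*} [NormedAddCommGroup F] [NormedSpace ℝ F]
    {G : (Fin n → ℝ) → F} {k : ℕ} (hk : 2 ≤ k) (hG : VanishesToOrderAtZero G k)
    (hs : ContDiffAt ℝ (⊤ : ℕ∞) G 0) : SameTwoJet G fun _ => 0 := by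
  refine ⟨hs, contDiffAt_const, ?_, ?_, ?_⟩
  · have := congrArg (fun T => T 0) (hG 0 (by omega))
    simpa using this
  · ext1 u
    have := congrArg (fun T => T fun _ => u) (hG 1 (by omega))
    simpa [iteratedFDeriv_one_apply] using this
  · ext1 u
    ext1 v
    have := congrArg (fun T => T ![u, v]) (hG 2 (by omega))
    simpa [iteratedFDeriv_two_apply] using this

theorem VanishesToOrderAtZero.fderiv {F : Type*} [NormedAddCommGroup F] [NormedSpace ℝ F]
    {G : (Fin n → ℝ) → F} {k : ℕ} (hG : VanishesToOrderAtZero G (k + 1)) :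
    VanishesToOrderAtZero (fderiv ℝ G) k := fun j hj => by
  rw [← norm_eq_zero, norm_iteratedFDeriv_fderiv, hG (j + 1) (by omega), norm_zero]

theorem contDiffAt_pullbackBilin {B : (Fin n → ℝ) → ((Fin n → ℝ) →L[ℝ] (Fin n → ℝ) →L[ℝ] ℝ)}
    {A : (Fin n → ℝ) → ((Fin n → ℝ) →L[ℝ] (Fin n → ℝ))}
    (hB : ContDiffAt ℝ (⊤ : ℕ∞) B 0) (hA : ContDiffAt ℝ (⊤ : ℕ∞) A 0) :
    ContDiffAt ℝ (⊤ : ℕ∞) (fun p => pullbackBilin (B p) (A p)) 0 :=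
  (hB.clm_comp hA).flip_form.clm_comp hA |>.flip_form

theorem fderiv_apply_apply_apply {B : (Fin n → ℝ) → ((Fin n → ℝ) →L[ℝ] (Fin n → ℝ) →L[ℝ] ℝ)}
    {x : Fin n → ℝ} (hB : DifferentiableAt ℝ B x) (u v w : Fin n → ℝ) :
    fderiv ℝ B x u v w = fderiv ℝ (fun p => B p v w) x u := by
  have := ((hB.hasFDerivAt.clm_apply (hasFDerivAt_const v x)).clm_apply
    (hasFDerivAt_const w x)).fderiv
  rw [this]
  simp

theorem fderiv_pullbackBilin {B : (Fin n → ℝ) → ((Fin n → ℝ) →L[ℝ] (Fin n → ℝ) →L[ℝ] ℝ)}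
    {f : (Fin n → ℝ) → (Fin n → ℝ)} (hB : ContDiffAt ℝ (⊤ : ℕ∞) B 0)
    (hf : ContDiffAt ℝ (⊤ : ℕ∞) f 0) (hf0 : f 0 = 0) (hf1 : fderiv ℝ f 0 = .id ℝ (Fin n → ℝ))
    (u v w : Fin n → ℝ) :
    fderiv ℝ (fun p => pullbackBilin (B (f p)) (fderiv ℝ f p)) 0 u v w =
      fderiv ℝ B 0 u v w + B 0 (fderiv ℝ (fderiv ℝ f) 0 u v) w +
        B 0 v (fderiv ℝ (fderiv ℝ f) 0 u w) := by
  have hBf : ContDiffAt ℝ (⊤ : ℕ∞) B (f 0) := by rwa [hf0]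
  have hB' := hBf.differentiableAt_top.hasFDerivAt.comp 0 hf.differentiableAt_top.hasFDerivAt
  have hf2 := hf.fderiv_top.differentiableAt_top.hasFDerivAt
  have hpull := contDiffAt_pullbackBilin (hBf.comp 0 hf) hf.fderiv_top
  simp only [Function.comp_def] at hpull
  rw [fderiv_apply_apply_apply hpull.differentiableAt_top]
  simp only [pullbackBilin_apply]
  have := ((hB'.clm_apply (hf2.clm_apply (hasFDerivAt_const v 0))).clm_apply
    (hf2.clm_apply (hasFDerivAt_const w 0))).fderiv
  simp only [Function.comp_def] at this
  rw [this]
  simp [hf0, hf1]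
  ring

/-- The exterior derivative of a family of linear forms. -/
noncomputable def extDerivForm (ω : (Fin n → ℝ) → ((Fin n → ℝ) →L[ℝ] ℝ)) (p : Fin n → ℝ) :
    (Fin n → ℝ) →L[ℝ] (Fin n → ℝ) →L[ℝ] ℝ :=
  fderiv ℝ ω p - (fderiv ℝ ω p).flip

theorem extDerivForm_apply (ω : (Fin n → ℝ) → ((Fin n → ℝ) →L[ℝ] ℝ)) (p v w : Fin n → ℝ) :
    extDerivForm ω p v w = fderiv ℝ ω p v w - fderiv ℝ ω p w v :=
  rfl

theorem contDiffAt_extDerivForm {ω : (Fin n → ℝ) → ((Fin n → ℝ) →L[ℝ] ℝ)}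
    (hω : ContDiffAt ℝ (⊤ : ℕ∞) ω 0) : ContDiffAt ℝ (⊤ : ℕ∞) (extDerivForm ω) 0 :=
  hω.fderiv_top.sub hω.fderiv_top.flip_form

theorem fderiv_comp_sub_smul {ω : (Fin n → ℝ) → ((Fin n → ℝ) →L[ℝ] ℝ)}
    {f : (Fin n → ℝ) → (Fin n → ℝ)} {a : (Fin n → ℝ) → ℝ} {p : Fin n → ℝ}
    (hωf : DifferentiableAt ℝ ω (f p)) (hω : DifferentiableAt ℝ ω p)
    (hf : DifferentiableAt ℝ f p) (hf' : DifferentiableAt ℝ (fderiv ℝ f) p)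
    (ha : DifferentiableAt ℝ a p) (v w : Fin n → ℝ) :
    fderiv ℝ (fun p => (ω (f p)).comp (fderiv ℝ f p) - a p • ω p) p v w =
      fderiv ℝ ω (f p) (fderiv ℝ f p v) (fderiv ℝ f p w) +
        ω (f p) (fderiv ℝ (fderiv ℝ f) p v w) - (fderiv ℝ a p v * ω p w +
          a p * fderiv ℝ ω p v w) := by
  have h1 := (hωf.hasFDerivAt.comp p hf.hasFDerivAt).clm_comp hf'.hasFDerivAt
  have h2 := (h1.fun_sub (ha.hasFDerivAt.fun_smul hω.hasFDerivAt)).fderiv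
  simp only [Function.comp_def] at h2
  rw [h2]
  simp
  ring

/-- `d` of the relation `f^* ω = a ω`, up to the exterior derivative of the error term. -/
theorem pullbackBilin_extDerivForm {ω : (Fin n → ℝ) → ((Fin n → ℝ) →L[ℝ] ℝ)}
    {f : (Fin n → ℝ) → (Fin n → ℝ)} {a : (Fin n → ℝ) → ℝ} {p : Fin n → ℝ}
    (hωf : DifferentiableAt ℝ ω (f p)) (hω : DifferentiableAt ℝ ω p)
    (hf : ContDiffAt ℝ (⊤ : ℕ∞) f p) (ha : DifferentiableAt ℝ a p) :
    pullbackBilin (extDerivForm ω (f p)) (fderiv ℝ f p) =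
      extDerivForm (fun p => (ω (f p)).comp (fderiv ℝ f p) - a p • ω p) p +
        ((fderiv ℝ a p).smulRight (ω p) - (ω p).smulRight (fderiv ℝ a p) +
          a p • extDerivForm ω p) := by
  ext1 v
  ext1 w
  have hsymm := hf.isSymmSndFDerivAt (by simp; norm_cast) v w
  have hf0 := hf.differentiableAt_top
  have hf' := hf.fderiv_top.differentiableAt_top
  simp only [pullbackBilin_apply, extDerivForm_apply, add_apply, sub_apply, smul_apply,
    ContinuousLinearMap.smulRight_apply, smul_eq_mul,
    fderiv_comp_sub_smul hωf hω hf0 hf' ha, hsymm]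
  ring

theorem SameTwoJet.det_borderedMatrix {B C : (Fin n → ℝ) → ((Fin n → ℝ) →L[ℝ] (Fin n → ℝ) →L[ℝ] ℝ)}
    {w w' : (Fin n → ℝ) → ((Fin n → ℝ) →L[ℝ] ℝ)} (ε : ℝ) (hB : SameTwoJet B C)
    (hw : SameTwoJet w w') :
    SameTwoJet (fun p => (borderedMatrix ε (formMatrix (B p)) (formVector (w p))).det)
      (fun p => (borderedMatrix ε (formMatrix (C p)) (formVector (w' p))).det) := by
  have hw' : ∀ i, SameTwoJet (fun p => formVector (w p) i) (fun p => formVector (w' p) i) :=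
    fun i => hw.clm (ContinuousLinearMap.apply ℝ ℝ (Pi.single i 1))
  refine SameTwoJet.det fun i j => ?_
  rcases i with i | i <;> rcases j with j | j
  · exact (hB.clm (ContinuousLinearMap.apply ℝ ((Fin n → ℝ) →L[ℝ] ℝ) (Pi.single i 1))).clm
      (ContinuousLinearMap.apply ℝ ℝ (Pi.single j 1))
  · exact hw' i
  · exact (hw' j).const_mul ε
  · exact SameTwoJet.refl contDiffAt_const

theorem det_borderedMatrix_pullbackBilin (ε : ℝ)
    (B : (Fin n → ℝ) →L[ℝ] (Fin n → ℝ) →L[ℝ] ℝ) (w : (Fin n → ℝ) →L[ℝ] ℝ)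
    (A : (Fin n → ℝ) →L[ℝ] (Fin n → ℝ)) :
    (borderedMatrix ε (formMatrix (pullbackBilin B A)) (formVector (w.comp A))).det =
      (endMatrix A).det ^ 2 * (borderedMatrix ε (formMatrix B) (formVector w)).det := by
  rw [← det_borderedMatrix_congr, endMatrix_transpose_mul_formMatrix_mul,
    formVector_vecMul_endMatrix]
  rfl

theorem det_borderedMatrix_add_smulRight (ε a : ℝ) (ha : a ≠ 0)
    (B : (Fin n → ℝ) →L[ℝ] (Fin n → ℝ) →L[ℝ] ℝ) (w γ : (Fin n → ℝ) →L[ℝ] ℝ) :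
    (borderedMatrix ε (formMatrix (B + w.smulRight γ + ε • γ.smulRight w))
      (formVector (a • w))).det =
      (borderedMatrix ε (formMatrix B) (a • formVector w)).det := by
  rw [← det_borderedMatrix_add ε (formMatrix B) (a • formVector w) (a⁻¹ • formVector γ)]
  congr 2
  ext i j
  simp [formMatrix, formVector, Matrix.vecMulVec]
  field_simp

theorem det_borderedMatrix_formMatrix_ne_zero (ε : ℝ) (hε : ε ≠ 0)
    (B : (Fin n → ℝ) →L[ℝ] (Fin n → ℝ) →L[ℝ] ℝ) (w : (Fin n → ℝ) →L[ℝ] ℝ) (hw : w ≠ 0)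
    (hB : ∀ x, w x = 0 → (∀ y, w y = 0 → B y x = 0) → x = 0) :
    (borderedMatrix ε (formMatrix B) (formVector w)).det ≠ 0 := by
  refine det_borderedMatrix_ne_zero ε _ _ hε (fun h => hw ?_) ?_
  · ext1 x
    rw [← formVector_dotProduct, h]
    simp
  · simpa only [formVector_dotProduct, formMatrix_dotProduct] using hB

end Pullback

section ConformalFactor

variable {n : ℕ}

/-- The ratio of the bordered determinants of `dω` and `h`: a rational invariant of the contact
sub-Riemannian structure which is homogeneous of degree `n - 1` in `ω`. -/
noncomputable def contactDensity (ω : (Fin n → ℝ) → ((Fin n → ℝ) →L[ℝ] ℝ))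
    (h : (Fin n → ℝ) → ((Fin n → ℝ) →L[ℝ] (Fin n → ℝ) →L[ℝ] ℝ)) (p : Fin n → ℝ) : ℝ :=
  (borderedMatrix (-1) (formMatrix (extDerivForm ω p)) (formVector (ω p))).det /
    (borderedMatrix 1 (formMatrix (h p)) (formVector (ω p))).det

theorem sameTwoJet_contactDensity {d : ℕ} (hn : n = 2 * d + 1)
    {ω β : (Fin n → ℝ) → ((Fin n → ℝ) →L[ℝ] ℝ)}
    {h : (Fin n → ℝ) → ((Fin n → ℝ) →L[ℝ] (Fin n → ℝ) →L[ℝ] ℝ)}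
    {f : (Fin n → ℝ) → (Fin n → ℝ)} {a : (Fin n → ℝ) → ℝ}
    (hω : ContDiffAt ℝ (⊤ : ℕ∞) ω 0) (hh : ContDiffAt ℝ (⊤ : ℕ∞) h 0)
    (hf : ContDiffAt ℝ (⊤ : ℕ∞) f 0) (ha : ContDiffAt ℝ (⊤ : ℕ∞) a 0)
    (hf0 : f 0 = 0) (ha0 : a 0 = 1)
    (hΩne : (borderedMatrix (-1) (formMatrix (extDerivForm ω 0)) (formVector (ω 0))).det ≠ 0)
    (hhne : (borderedMatrix 1 (formMatrix (h 0)) (formVector (ω 0))).det ≠ 0)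
    (hisoω : SameTwoJet (fun p => (ω (f p)).comp (fderiv ℝ f p)) fun p => a p • ω p)
    (hisoΩ : SameTwoJet (fun p => pullbackBilin (extDerivForm ω (f p)) (fderiv ℝ f p)) fun p =>
      (fderiv ℝ a p).smulRight (ω p) - (ω p).smulRight (fderiv ℝ a p) + a p • extDerivForm ω p)
    (hisoh : SameTwoJet (fun p => pullbackBilin (h (f p)) (fderiv ℝ f p)) fun p =>
      h p + (ω p).smulRight (β p) + (β p).smulRight (ω p)) :
    ContDiffAt ℝ (⊤ : ℕ∞) (contactDensity ω h) 0 ∧ contactDensity ω h 0 ≠ 0 ∧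
    SameTwoJet (fun p => contactDensity ω h (f p))
      (fun p => a p ^ (2 * d) * contactDensity ω h p) := by
  have hane : ∀ᶠ p in nhds 0, a p ≠ 0 := ha.continuousAt.eventually_ne (by simp [ha0])
  obtain ⟨N₁, hN₁⟩ : ∃ N : (Fin n → ℝ) → ℝ, N = fun p =>
    (borderedMatrix (-1) (formMatrix (extDerivForm ω p)) (formVector (ω p))).det := ⟨_, rfl⟩
  obtain ⟨N₂, hN₂⟩ : ∃ N : (Fin n → ℝ) → ℝ, N = fun p =>
    (borderedMatrix 1 (formMatrix (h p)) (formVector (ω p))).det := ⟨_, rfl⟩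
  have hψ : contactDensity ω h = fun p => N₁ p * (N₂ p)⁻¹ := by
    ext p
    rw [hN₁, hN₂, contactDensity, div_eq_mul_inv]
  have hs₁ : ContDiffAt ℝ (⊤ : ℕ∞) N₁ 0 := hN₁ ▸
    (SameTwoJet.det_borderedMatrix (-1) (.refl (contDiffAt_extDerivForm hω)) (.refl hω)).left
  have hs₂ : ContDiffAt ℝ (⊤ : ℕ∞) N₂ 0 := hN₂ ▸
    (SameTwoJet.det_borderedMatrix 1 (.refl hh) (.refl hω)).left
  have h₁0 : N₁ 0 ≠ 0 := by rwa [hN₁]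
  have h₂0 : N₂ 0 ≠ 0 := by rwa [hN₂]
  have hψs : ContDiffAt ℝ (⊤ : ℕ∞) (contactDensity ω h) 0 := hψ ▸ hs₁.mul (hs₂.inv h₂0)
  have hψf : ContDiffAt ℝ (⊤ : ℕ∞) (fun p => contactDensity ω h (f p)) 0 :=
    ContDiffAt.comp (g := contactDensity ω h) 0 (by rwa [hf0]) hf
  have hrel₁ : SameTwoJet (fun p => (endMatrix (fderiv ℝ f p)).det ^ 2 * N₁ (f p))
      (fun p => a p ^ (2 * d + 2) * N₁ p) := by
    have hdet := SameTwoJet.det_borderedMatrix (-1) hisoΩ hisoω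
    simp only [det_borderedMatrix_pullbackBilin] at hdet
    rw [hN₁]
    refine hdet.trans (.of_eventuallyEq hdet.right (hane.mono fun p hp => ?_))
    have : (fderiv ℝ a p).smulRight (ω p) - (ω p).smulRight (fderiv ℝ a p) +
        a p • extDerivForm ω p = a p • extDerivForm ω p + (ω p).smulRight (-fderiv ℝ a p) +
          (-1 : ℝ) • (-fderiv ℝ a p).smulRight (ω p) := by
      ext1 v
      ext1 w
      simp
      ring
    beta_reduce
    rw [this, det_borderedMatrix_add_smulRight _ _ hp]
    have := det_borderedMatrix_smul_smul (-1) (a p) (formMatrix (extDerivForm ω p))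
      (formVector (ω p))
    rw [Fintype.card_fin, show n + 1 = 2 * d + 2 by omega] at this
    exact this
  have hrel₂ : SameTwoJet (fun p => (endMatrix (fderiv ℝ f p)).det ^ 2 * N₂ (f p))
      (fun p => a p ^ 2 * N₂ p) := by
    have hdet := SameTwoJet.det_borderedMatrix 1 hisoh hisoω
    simp only [det_borderedMatrix_pullbackBilin] at hdet
    rw [hN₂]
    refine hdet.trans (.of_eventuallyEq hdet.right (hane.mono fun p hp => ?_))
    have := det_borderedMatrix_add_smulRight 1 _ hp (h p) (ω p) (β p)
    rw [one_smul] at this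
    beta_reduce
    rw [this, det_borderedMatrix_smul]
  have hne₂ : ∀ᶠ p in nhds 0, N₂ p ≠ 0 := hs₂.continuousAt.eventually_ne h₂0
  have hne₂f : ∀ᶠ p in nhds 0, N₂ (f p) ≠ 0 := by
    have := hf.continuousAt.tendsto
    rw [hf0] at this
    exact this.eventually hne₂
  have hc : ContDiffAt ℝ (⊤ : ℕ∞) (fun p => (a p ^ 2 * N₂ p)⁻¹) 0 :=
    ((ha.pow 2).mul hs₂).inv (by simp [ha0, h₂0])
  refine ⟨hψs, by simp [hψ, h₁0, h₂0], ?_⟩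
  have step₁ := SameTwoJet.of_eventuallyEq (B := fun p =>
      (a p ^ 2 * N₂ p)⁻¹ * (contactDensity ω h (f p) * (a p ^ 2 * N₂ p))) hψf <| by
    filter_upwards [hane, hne₂] with p hp hp'
    field_simp
  have step₂ := (SameTwoJet.refl hc).mul ((SameTwoJet.refl hψf).mul hrel₂.symm)
  have step₃ := SameTwoJet.of_eventuallyEq (B := fun p => (a p ^ 2 * N₂ p)⁻¹ *
      ((endMatrix (fderiv ℝ f p)).det ^ 2 * N₁ (f p))) step₂.right <| by
    filter_upwards [hne₂f] with p hp
    rw [hψ]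
    field_simp
  have step₄ := (SameTwoJet.refl hc).mul hrel₁
  have step₅ := SameTwoJet.of_eventuallyEq
      (B := fun p => a p ^ (2 * d) * contactDensity ω h p) step₄.right <| by
    filter_upwards [hane, hne₂] with p hp hp'
    rw [hψ]
    field_simp
    ring
  exact step₁.trans (step₂.trans (step₃.trans (step₄.trans step₅)))

end ConformalFactor

section Isometry

variable {n : ℕ}

theorem sameTwoJet_pullbackBilin_extDerivForm {ω : (Fin n → ℝ) → ((Fin n → ℝ) →L[ℝ] ℝ)}
    {f : (Fin n → ℝ) → (Fin n → ℝ)} {a : (Fin n → ℝ) → ℝ}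
    (hω : ContDiffAt ℝ (⊤ : ℕ∞) ω 0) (hf : ContDiffAt ℝ (⊤ : ℕ∞) f 0)
    (ha : ContDiffAt ℝ (⊤ : ℕ∞) a 0) (hf0 : f 0 = 0)
    (hfs : ∀ᶠ p in nhds 0, ContDiffAt ℝ (⊤ : ℕ∞) f p)
    (hG : SameTwoJet (fderiv ℝ fun p => (ω (f p)).comp (fderiv ℝ f p) - a p • ω p) fun _ => 0) :
    SameTwoJet (fun p => pullbackBilin (extDerivForm ω (f p)) (fderiv ℝ f p)) fun p =>
      (fderiv ℝ a p).smulRight (ω p) - (ω p).smulRight (fderiv ℝ a p) + a p • extDerivForm ω p := by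
  have hωf : ContDiffAt ℝ (⊤ : ℕ∞) ω (f 0) := by rwa [hf0]
  have hdG : SameTwoJet (extDerivForm fun p => (ω (f p)).comp (fderiv ℝ f p) - a p • ω p)
      fun _ => 0 := by
    have := hG.add (hG.flip_form.clm (-ContinuousLinearMap.id ℝ _))
    convert this using 1
    · ext1 p
      ext v w
      exact sub_eq_add_neg (_ : ℝ) _
    · ext p v w
      simp
  refine hdG.of_eventuallyEq_add (((ha.fderiv_top.smulRight hω).sub
    (hω.smulRight ha.fderiv_top)).add (ha.smul (contDiffAt_extDerivForm hω))) ?_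
  filter_upwards [hω.eventually_differentiableAt, ha.eventually_differentiableAt, hfs,
    hf.continuousAt.eventually hωf.eventually_differentiableAt] with p hp ha' hf' hωf'
  exact pullbackBilin_extDerivForm hωf' hp hf' ha'

theorem extDerivForm_second_fderiv {ω : (Fin n → ℝ) → ((Fin n → ℝ) →L[ℝ] ℝ)}
    {f : (Fin n → ℝ) → (Fin n → ℝ)} {a : (Fin n → ℝ) → ℝ}
    (hω : ContDiffAt ℝ (⊤ : ℕ∞) ω 0) (hf : ContDiffAt ℝ (⊤ : ℕ∞) f 0)
    (ha : ContDiffAt ℝ (⊤ : ℕ∞) a 0) (hf0 : f 0 = 0)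
    (hf1 : fderiv ℝ f 0 = .id ℝ (Fin n → ℝ)) (ha0 : a 0 = 1) (ha1 : fderiv ℝ a 0 = 0)
    (hiso : SameTwoJet (fun p => pullbackBilin (extDerivForm ω (f p)) (fderiv ℝ f p)) fun p =>
      (fderiv ℝ a p).smulRight (ω p) - (ω p).smulRight (fderiv ℝ a p) + a p • extDerivForm ω p)
    (u v x : Fin n → ℝ) :
    extDerivForm ω 0 (fderiv ℝ (fderiv ℝ f) 0 u v) x +
        extDerivForm ω 0 v (fderiv ℝ (fderiv ℝ f) 0 u x) =
      fderiv ℝ (fderiv ℝ a) 0 u v * ω 0 x - fderiv ℝ (fderiv ℝ a) 0 u x * ω 0 v := by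
  have hΩ := contDiffAt_extDerivForm hω
  have h1 := congrArg (fun T => T u v x) hiso.first
  beta_reduce at h1
  rw [fderiv_pullbackBilin hΩ hf hf0 hf1,
    fderiv_apply_apply_apply hiso.right.differentiableAt_top] at h1
  have hc := fun {B : (Fin n → ℝ) → ((Fin n → ℝ) →L[ℝ] ℝ)} (hB : ContDiffAt ℝ (⊤ : ℕ∞) B 0) y =>
    hB.differentiableAt_top.hasFDerivAt.clm_apply (hasFDerivAt_const y (0 : Fin n → ℝ))
  have hΩc := (hΩ.differentiableAt_top.hasFDerivAt.clm_apply
    (hasFDerivAt_const v (0 : Fin n → ℝ))).clm_apply (hasFDerivAt_const x (0 : Fin n → ℝ))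
  have h2 := ((((hc ha.fderiv_top v).fun_mul (hc hω x)).fun_sub
    ((hc hω v).fun_mul (hc ha.fderiv_top x))).fun_add
    (ha.differentiableAt_top.hasFDerivAt.fun_mul hΩc)).fderiv
  simp only [add_apply, sub_apply, smul_apply,
    ContinuousLinearMap.smulRight_apply, smul_eq_mul] at h1
  rw [h2] at h1
  simp [ha0, ha1] at h1
  linarith

theorem bilin_second_fderiv {ω β : (Fin n → ℝ) → ((Fin n → ℝ) →L[ℝ] ℝ)}
    {h : (Fin n → ℝ) → ((Fin n → ℝ) →L[ℝ] (Fin n → ℝ) →L[ℝ] ℝ)}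
    {f : (Fin n → ℝ) → (Fin n → ℝ)}
    (hω : ContDiffAt ℝ (⊤ : ℕ∞) ω 0) (hβ : ContDiffAt ℝ (⊤ : ℕ∞) β 0)
    (hh : ContDiffAt ℝ (⊤ : ℕ∞) h 0) (hf : ContDiffAt ℝ (⊤ : ℕ∞) f 0) (hf0 : f 0 = 0)
    (hf1 : fderiv ℝ f 0 = .id ℝ (Fin n → ℝ)) (hω0 : ω 0 ≠ 0)
    (hiso : SameTwoJet (fun p => pullbackBilin (h (f p)) (fderiv ℝ f p)) fun p =>
      h p + (ω p).smulRight (β p) + (β p).smulRight (ω p))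
    (u v x : Fin n → ℝ) (hv : ω 0 v = 0) (hx : ω 0 x = 0) :
    h 0 (fderiv ℝ (fderiv ℝ f) 0 u v) x + h 0 v (fderiv ℝ (fderiv ℝ f) 0 u x) = 0 := by
  obtain ⟨z, hz⟩ : ∃ z, ω 0 z ≠ 0 := by
    by_contra! hall
    exact hω0 (ContinuousLinearMap.ext hall)
  have h0 : ∀ y y', ω 0 y * β 0 y' + β 0 y * ω 0 y' = 0 := fun y y' => by
    have := congrArg (fun T => T y y') hiso.value
    simp [pullbackBilin_apply, hf0, hf1] at this
    linarith
  have hβz : β 0 z = 0 := by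
    have : 2 * (ω 0 z * β 0 z) = 0 := by linarith [h0 z z]
    simpa [hz] using this
  have hβ0 : ∀ y, β 0 y = 0 := fun y => by simpa [hβz, hz] using h0 z y
  have h1 := congrArg (fun T => T u v x) hiso.first
  beta_reduce at h1
  rw [fderiv_pullbackBilin hh hf hf0 hf1,
    fderiv_apply_apply_apply hiso.right.differentiableAt_top] at h1
  have hc := fun {B : (Fin n → ℝ) → ((Fin n → ℝ) →L[ℝ] ℝ)} (hB : ContDiffAt ℝ (⊤ : ℕ∞) B 0) y =>
    hB.differentiableAt_top.hasFDerivAt.clm_apply (hasFDerivAt_const y (0 : Fin n → ℝ))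
  have hhc := (hh.differentiableAt_top.hasFDerivAt.clm_apply
    (hasFDerivAt_const v (0 : Fin n → ℝ))).clm_apply (hasFDerivAt_const x (0 : Fin n → ℝ))
  have h2 := ((hhc.fun_add ((hc hω v).fun_mul (hc hβ x))).fun_add
    ((hc hβ v).fun_mul (hc hω x))).fderiv
  simp only [add_apply, ContinuousLinearMap.smulRight_apply, smul_eq_mul, smul_apply] at h1
  rw [h2] at h1
  simp [hv, hx, hβ0] at h1
  linarith

end Isometry

/-- **Contact sub-Riemannian metrics are `(4,1)`-sub-rigid** (Theorem 2 of the paper).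
On a neighborhood `U` of `0` in `ℝⁿ`, `n = 2d+1`, let `ω` be a smooth nonvanishing family
of linear forms which is contact (the form `dω_p(v,w) = Dω_p(v)(w) − Dω_p(w)(v)` is
nondegenerate on `ker ω_p`), and let `h` be a smooth family of symmetric bilinear forms,
positive definite on `ker ω_p`.  If `f` is a `4`-infinitesimal isometry at `0` of the
contact sub-Riemannian structure `(ker ω, h)` — i.e. `f(0) = 0` and, for some smooth
`a : U → ℝ` and smooth family of linear forms `β`, the maps `p ↦ (f*ω)_p − a(p)·ω_p` and
`p ↦ (f*h)_p − h_p − (ω_p ⊗ β_p + β_p ⊗ ω_p)` vanish to order `3` at `0` — and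
`Df(0) = id`, then `D²f(0) = 0`. -/
theorem contact_subRiemannian_is_four_one_subrigid
    (d : ℕ) (hd : 1 ≤ d) (n : ℕ) (hn : n = 2 * d + 1)
    (U : Set (Fin n → ℝ)) (hU : IsOpen U) (hU0 : (0 : Fin n → ℝ) ∈ U)
    (ω : (Fin n → ℝ) → ((Fin n → ℝ) →L[ℝ] ℝ))
    (hω : ContDiffOn ℝ (⊤ : ℕ∞) ω U)
    (hωne : ∀ p ∈ U, ω p ≠ 0)
    (hcontact : ∀ p ∈ U, ∀ v : Fin n → ℝ, ω p v = 0 →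
      (∀ w : Fin n → ℝ, ω p w = 0 → fderiv ℝ ω p v w - fderiv ℝ ω p w v = 0) → v = 0)
    (h : (Fin n → ℝ) → ((Fin n → ℝ) →L[ℝ] (Fin n → ℝ) →L[ℝ] ℝ))
    (hh : ContDiffOn ℝ (⊤ : ℕ∞) h U)
    (hsym : ∀ p ∈ U, ∀ v w : Fin n → ℝ, h p v w = h p w v)
    (hpos : ∀ p ∈ U, ∀ v : Fin n → ℝ, ω p v = 0 → v ≠ 0 → 0 < h p v v)
    (f : (Fin n → ℝ) → (Fin n → ℝ)) (hf : ContDiffOn ℝ (⊤ : ℕ∞) f U) (hf0 : f 0 = 0)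
    (a : (Fin n → ℝ) → ℝ) (ha : ContDiffOn ℝ (⊤ : ℕ∞) a U)
    (β : (Fin n → ℝ) → ((Fin n → ℝ) →L[ℝ] ℝ)) (hβ : ContDiffOn ℝ (⊤ : ℕ∞) β U)
    (hisoω : VanishesToOrderAtZero
      (fun p => (ω (f p)).comp (fderiv ℝ f p) - a p • ω p) 3)
    (hisoh : VanishesToOrderAtZero
      (fun p => pullbackBilin (h (f p)) (fderiv ℝ f p) - h p
        - (ω p).smulRight (β p) - (β p).smulRight (ω p)) 3)
    (hjet1 : fderiv ℝ f 0 = ContinuousLinearMap.id ℝ (Fin n → ℝ)) :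
    iteratedFDeriv ℝ 2 f 0 = 0 := by
  have hf0U : f 0 ∈ U := by rwa [hf0]
  have hUn : U ∈ nhds (0 : Fin n → ℝ) := hU.mem_nhds hU0
  have sω := hω.contDiffAt hUn
  have sh := hh.contDiffAt hUn
  have sf := hf.contDiffAt hUn
  have sa := ha.contDiffAt hUn
  have sβ := hβ.contDiffAt hUn
  have sωf : ContDiffAt ℝ (⊤ : ℕ∞) (fun p => ω (f p)) 0 :=
    (hω.contDiffAt (hU.mem_nhds hf0U)).comp 0 sf
  have shf : ContDiffAt ℝ (⊤ : ℕ∞) (fun p => h (f p)) 0 :=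
    (hh.contDiffAt (hU.mem_nhds hf0U)).comp 0 sf
  have sG := (sωf.clm_comp sf.fderiv_top).sub (sa.smul sω)
  have jω : SameTwoJet (fun p => (ω (f p)).comp (fderiv ℝ f p)) fun p => a p • ω p :=
    (hisoω.sameTwoJet (by norm_num) sG).of_eventuallyEq_add (sa.smul sω)
      (.of_forall fun p => by simp)
  have jΩ := sameTwoJet_pullbackBilin_extDerivForm sω sf sa hf0
    (Filter.eventually_of_mem hUn fun p hp => hf.contDiffAt (hU.mem_nhds hp))
    (hisoω.fderiv.sameTwoJet le_rfl sG.fderiv_top)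
  have jh : SameTwoJet (fun p => pullbackBilin (h (f p)) (fderiv ℝ f p)) fun p =>
      h p + (ω p).smulRight (β p) + (β p).smulRight (ω p) :=
    (hisoh.sameTwoJet (by norm_num) ((((contDiffAt_pullbackBilin shf sf.fderiv_top).sub sh).sub
      (sω.smulRight sβ)).sub (sβ.smulRight sω))).of_eventuallyEq_add
      ((sh.add (sω.smulRight sβ)).add (sβ.smulRight sω)) (.of_forall fun p => by abel)
  have hω0 := hωne 0 hU0
  have ha0 : a 0 = 1 := by
    have := jω.value
    rw [hf0, hjet1, ContinuousLinearMap.comp_id] at this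
    exact smul_left_injective ℝ hω0 (by simpa using this.symm)
  have hnd : ∀ x, ω 0 x = 0 → (∀ y, ω 0 y = 0 → extDerivForm ω 0 y x = 0) → x = 0 :=
    fun x hx hy => hcontact 0 hU0 x hx fun y hy' => by
      have := hy y hy'
      rw [extDerivForm_apply] at this
      linarith
  obtain ⟨sψ, hψ0, jψ⟩ := sameTwoJet_contactDensity hn sω sh sf sa hf0 ha0
    (det_borderedMatrix_formMatrix_ne_zero _ (by norm_num) _ _ hω0 hnd)
    (det_borderedMatrix_formMatrix_ne_zero _ one_ne_zero _ _ hω0 fun x hx hy => by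
      by_contra hx0
      exact (hpos 0 hU0 x hx hx0).ne' (hy x hx)) jω jΩ jh
  obtain ⟨ha1, θ, hθ⟩ :=
    jψ.conformal_factor (k := 2 * d) (by omega) sψ sa sf hf0 hjet1 hψ0 ha0
  have hωS : ∀ u v, ω 0 (fderiv ℝ (fderiv ℝ f) 0 u v) = 0 := fun u v => by
    have h1 := fderiv_comp_sub_smul (ω := ω) (f := f) (a := a) (p := 0)
      (by rw [hf0]; exact sω.differentiableAt_top) sω.differentiableAt_top sf.differentiableAt_top
      sf.fderiv_top.differentiableAt_top sa.differentiableAt_top u v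
    rw [(hisoω.sameTwoJet (by norm_num) sG).first] at h1
    simpa [hf0, hjet1, ha0, ha1] using h1.symm
  have hS := contact_symmetric_bilinear_eq_zero ⟨d, hn⟩ (ω 0)
    (extDerivForm ω 0 - θ.smulRight (ω 0) + (ω 0).smulRight θ) (h 0) (fderiv ℝ (fderiv ℝ f) 0)
    (fun v x => by simp [extDerivForm_apply]; ring)
    (fun v hv hx => hnd v hv fun y hy => by simpa [hv, hy] using hx y hy)
    (hsym 0 hU0) (hpos 0 hU0) (sf.isSymmSndFDerivAt (by simp; norm_cast)) hωS
    (fun u v x => by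
      have := extDerivForm_second_fderiv sω sf sa hf0 hjet1 ha0 ha1 jΩ u v x
      rw [hθ, hθ] at this
      simp [hωS]
      linarith)
    fun u v x _ hv hx => bilin_second_fderiv sω sβ sh sf hf0 hjet1 hω0 jh u v x hv hx
  ext1 m
  rw [iteratedFDeriv_two_apply, hS]
  rfl
end

section
/- On ℝ³ with coordinates p = (x,y,z), let ω_p(v) = v₃ − x·v₂ (the contact form dz − x dy), let h(v,w) = v₁w₁ + v₂w₂ (the constant symmetric bilinear form dx² + dy²), and let f(x,y,z) = (x + z²/2, y − z x²/2, z + y z²/2). Set a(p) = 1 + y z and β_p(v) = z·v₁ − (x²/2)·v₂ + (z²/2)·v₃. Then: (i) f(0) = 0 and Df(0) = id; (ii) the map p ↦ (f*ω)_p − a(p)·ω_p vanishes to order 2 at 0; (iii) the map p ↦ (f*h)_p − h_p − (ω_p ⊗ β_p + β_p ⊗ ω_p) vanishes to order 2 at 0; (iv) D²f(0) ≠ 0 (indeed ∂²f₁/∂z²(0) = 1). Consequently f is a 3-infinitesimal isometry of the contact sub-Riemannian structure (ker ω, h) at 0 with trivial 1-jet but nontrivial 2-jet, so this structure is not (3,1)-sub-rigid.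 -/
/-- The `i`-th coordinate projection on `ℝ³`, as a continuous linear form. -/
noncomputable def pr (i : Fin 3) : (Fin 3 → ℝ) →L[ℝ] ℝ :=
  ContinuousLinearMap.proj i

/-- The contact form `ω = dz − x dy` on `ℝ³`: `ω_p(v) = v₃ − x·v₂`. -/
noncomputable def ωEx (p : Fin 3 → ℝ) : (Fin 3 → ℝ) →L[ℝ] ℝ :=
  pr 2 - p 0 • pr 1

/-- The constant symmetric bilinear form `dx² + dy²` on `ℝ³`: `h(v,w) = v₁w₁ + v₂w₂`. -/
noncomputable def hEx : (Fin 3 → ℝ) →L[ℝ] (Fin 3 → ℝ) →L[ℝ] ℝ :=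
  (pr 0).smulRight (pr 0) + (pr 1).smulRight (pr 1)

/-- The map `f(x,y,z) = (x + z²/2, y − z x²/2, z + y z²/2)`. -/
noncomputable def fEx (p : Fin 3 → ℝ) : Fin 3 → ℝ :=
  ![p 0 + p 2 ^ 2 / 2, p 1 - p 2 * p 0 ^ 2 / 2, p 2 + p 1 * p 2 ^ 2 / 2]

/-- The conformal factor `a(p) = 1 + y z`. -/
noncomputable def aEx (p : Fin 3 → ℝ) : ℝ := 1 + p 1 * p 2

/-- The correction form `β_p(v) = z·v₁ − (x²/2)·v₂ + (z²/2)·v₃`. -/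
noncomputable def βEx (p : Fin 3 → ℝ) : (Fin 3 → ℝ) →L[ℝ] ℝ :=
  p 2 • pr 0 - (p 0 ^ 2 / 2) • pr 1 + (p 2 ^ 2 / 2) • pr 2

theorem VanishesToOrderAtZero.smul {n : ℕ} {F : Type*} [NormedAddCommGroup F] [NormedSpace ℝ F]
    {g : (Fin n → ℝ) → ℝ} {G : (Fin n → ℝ) → F} {k : ℕ} (hg : VanishesToOrderAtZero g k)
    (hgs : ContDiff ℝ ⊤ g) (hG : ContDiff ℝ ⊤ G) :
    VanishesToOrderAtZero (fun p => g p • G p) k := by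
  intro j hj
  rw [← norm_le_zero_iff]
  refine (norm_iteratedFDeriv_smul_le hgs hG 0 (n := j) le_top).trans
    (Finset.sum_nonpos fun i hi => ?_)
  rw [hg i (by grind)]
  simp

/-- Multiplying by a function that vanishes at `0` raises the order of vanishing by one. -/
theorem VanishesToOrderAtZero.smul_succ {n : ℕ} {F : Type*} [NormedAddCommGroup F]
    [NormedSpace ℝ F] {g : (Fin n → ℝ) → ℝ} {G : (Fin n → ℝ) → F} {k : ℕ}
    (hg : VanishesToOrderAtZero g k) (hgs : ContDiff ℝ ⊤ g) (hG : ContDiff ℝ ⊤ G)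
    (hG0 : G 0 = 0) : VanishesToOrderAtZero (fun p => g p • G p) (k + 1) := by
  intro j hj
  rw [← norm_le_zero_iff]
  refine (norm_iteratedFDeriv_smul_le hgs hG 0 (n := j) le_top).trans
    (Finset.sum_nonpos fun i hi => ?_)
  rcases Nat.lt_or_ge k i with hki | hki
  · obtain rfl : i = j := by grind
    rw [Nat.sub_self, norm_iteratedFDeriv_zero, hG0]
    simp
  · rw [hg i hki]
    simp

theorem VanishesToOrderAtZero.add {n : ℕ} {F : Type*} [NormedAddCommGroup F] [NormedSpace ℝ F]
    {G H : (Fin n → ℝ) → F} {k : ℕ} (hG : VanishesToOrderAtZero G k)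
    (hH : VanishesToOrderAtZero H k) (hGs : ContDiff ℝ ⊤ G) (hHs : ContDiff ℝ ⊤ H) :
    VanishesToOrderAtZero (fun p => G p + H p) k := by
  intro j hj
  rw [fun_iteratedFDeriv_add_apply (hGs.of_le le_top).contDiffAt (hHs.of_le le_top).contDiffAt,
    hG j hj, hH j hj, add_zero]

theorem vanishesToOrderAtZero_two_cubic_smul {n : ℕ} {F : Type*} [NormedAddCommGroup F]
    [NormedSpace ℝ F] (i j k : Fin n) {G : (Fin n → ℝ) → F} (hG : ContDiff ℝ ⊤ G) :
    VanishesToOrderAtZero (fun p => (p i * p j * p k) • G p) 2 := by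
  have linear : VanishesToOrderAtZero (fun p : Fin n → ℝ => p i) 0 := by
    intro m hm
    obtain rfl : m = 0 := by omega
    ext
    simp
  have quadratic := linear.smul_succ (G := fun p => p j) (by fun_prop) (by fun_prop) rfl
  have cubic := quadratic.smul_succ (G := fun p => p k) (by fun_prop) (by fun_prop) rfl
  exact cubic.smul (by fun_prop) hG

theorem vanishesToOrderAtZero_two_cubic_smul_add_cubic_smul {F : Type*} [NormedAddCommGroup F]
    [NormedSpace ℝ F] (A B C D E : F) :
    VanishesToOrderAtZero (fun p : Fin 3 → ℝ => (p 0 * p 2 * p 2) • (p 0 • A + B)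
      + (p 0 * p 0 * p 0) • (p 2 • C + p 0 • D - E)) 2 := by
  refine (vanishesToOrderAtZero_two_cubic_smul _ _ _ ?_).add
    (vanishesToOrderAtZero_two_cubic_smul _ _ _ ?_) ?_ ?_ <;> fun_prop

/-- The Jacobian of `fEx`. -/
noncomputable def fExDeriv (p : Fin 3 → ℝ) : (Fin 3 → ℝ) →L[ℝ] (Fin 3 → ℝ) :=
  ContinuousLinearMap.pi
    ![pr 0 + p 2 • pr 2,
      -(p 2 * p 0) • pr 0 + pr 1 - (p 0 ^ 2 / 2) • pr 2,
      (p 2 ^ 2 / 2) • pr 1 + (1 + p 1 * p 2) • pr 2]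

theorem hasFDerivAt_fEx (p : Fin 3 → ℝ) : HasFDerivAt fEx (fExDeriv p) p := by
  have hpr (i : Fin 3) : HasFDerivAt (fun q : Fin 3 → ℝ => q i) (pr i) p := (pr i).hasFDerivAt
  rw [hasFDerivAt_pi']
  intro i
  fin_cases i
  · refine ((hpr 0).add (((hpr 2).pow 2).mul_const (1 / 2))).congr_fderiv ?_
      |>.congr_of_eventuallyEq ?_
    · ext v
      simp [fExDeriv, pr]
      ring
    · exact .of_forall fun q => by simp [fEx]; ring
  · refine ((hpr 1).sub (((hpr 2).mul ((hpr 0).pow 2)).mul_const (1 / 2))).congr_fderiv ?_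
      |>.congr_of_eventuallyEq ?_
    · ext v
      simp [fExDeriv, pr]
      ring
    · exact .of_forall fun q => by simp [fEx]; ring
  · refine ((hpr 2).add (((hpr 1).mul ((hpr 2).pow 2)).mul_const (1 / 2))).congr_fderiv ?_
      |>.congr_of_eventuallyEq ?_
    · ext v
      simp [fExDeriv, pr]
      ring
    · exact .of_forall fun q => by simp [fEx]; ring

theorem fderiv_fEx : fderiv ℝ fEx = fExDeriv := funext fun p => (hasFDerivAt_fEx p).fderiv

theorem pullback_ωEx_sub (p : Fin 3 → ℝ) :
    (ωEx (fEx p)).comp (fExDeriv p) - aEx p • ωEx p =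
      (p 0 * p 0 * p 2) • (pr 0 + (p 2 / 4) • pr 2)
        + (p 0 * p 2 * p 2) • ((p 2 / 2) • pr 0)
        + (p 0 * p 1 * p 2) • pr 1
        + (p 0 * p 0 * p 0) • ((1 / 2 : ℝ) • pr 2) := by
  refine ContinuousLinearMap.ext fun v => ?_
  simp [ωEx, fEx, aEx, fExDeriv, pr]
  ring

theorem pullback_hEx_sub (p : Fin 3 → ℝ) :
    pullbackBilin hEx (fExDeriv p) - hEx
        - (ωEx p).smulRight (βEx p) - (βEx p).smulRight (ωEx p) =
      (p 0 * p 2 * p 2) • (p 0 • (pr 0).smulRight (pr 0)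
          + (1 / 2 : ℝ) • ((pr 1).smulRight (pr 2) + (pr 2).smulRight (pr 1)))
        + (p 0 * p 0 * p 0) • (p 2 • ((1 / 2 : ℝ) • ((pr 0).smulRight (pr 2) + (pr 2).smulRight (pr 0)))
          + p 0 • ((1 / 4 : ℝ) • (pr 2).smulRight (pr 2)) - (pr 1).smulRight (pr 1)) := by
  refine ContinuousLinearMap.ext fun v => ContinuousLinearMap.ext fun w => ?_
  simp [pullbackBilin, hEx, ωEx, βEx, fExDeriv, pr]
  ring

/-- **The contact sub-Riemannian structure `(ker(dz − x dy), dx² + dy²)` on `ℝ³` is not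
`(3,1)`-sub-rigid:** the map `f(x,y,z) = (x + z²/2, y − z x²/2, z + y z²/2)` is a
`3`-infinitesimal isometry at `0` with trivial `1`-jet (`f(0) = 0`, `Df(0) = id`) but
nontrivial `2`-jet (`D²f(0) ≠ 0`). -/
theorem contact_subRiemannian_not_three_one_subrigid :
    fEx 0 = 0 ∧
    fderiv ℝ fEx 0 = ContinuousLinearMap.id ℝ (Fin 3 → ℝ) ∧
    VanishesToOrderAtZero
      (fun p => (ωEx (fEx p)).comp (fderiv ℝ fEx p) - aEx p • ωEx p) 2 ∧
    VanishesToOrderAtZero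
      (fun p => pullbackBilin hEx (fderiv ℝ fEx p) - hEx
        - (ωEx p).smulRight (βEx p) - (βEx p).smulRight (ωEx p)) 2 ∧
    iteratedFDeriv ℝ 2 fEx 0 ≠ 0 := by
  rw [fderiv_fEx]
  refine ⟨?_, ?_, ?_, ?_, fun h => ?_⟩
  · ext i
    fin_cases i <;> simp [fEx]
  · refine ContinuousLinearMap.ext fun v => funext fun i => ?_
    fin_cases i <;> simp [fExDeriv, pr]
  · simp only [pullback_ωEx_sub]
    refine (((vanishesToOrderAtZero_two_cubic_smul _ _ _ ?_).add
      (vanishesToOrderAtZero_two_cubic_smul _ _ _ ?_) ?_ ?_).add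
      (vanishesToOrderAtZero_two_cubic_smul _ _ _ ?_) ?_ ?_).add
      (vanishesToOrderAtZero_two_cubic_smul _ _ _ ?_) ?_ ?_ <;> fun_prop
  · simp only [pullback_hEx_sub]
    exact vanishesToOrderAtZero_two_cubic_smul_add_cubic_smul _ _ _ _ _
  · have hdiff : DifferentiableAt ℝ fExDeriv 0 := by
      have hf : ContDiff ℝ 2 fEx := by
        rw [contDiff_pi]
        intro i
        fin_cases i <;> simp [fEx] <;> fun_prop
      rw [← fderiv_fEx]
      exact (hf.fderiv_right (m := 1) (by norm_num)).differentiable (by norm_num) 0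
    have hzero : fderiv ℝ fExDeriv 0 (Pi.single 2 1) (Pi.single 2 1) = 0 := by
      have := congrArg (fun D => D ![Pi.single 2 1, Pi.single 2 1]) h
      simpa [iteratedFDeriv_two_apply, fderiv_fEx] using this
    have hentry : HasFDerivAt (fun p => pr 0 (fExDeriv p (Pi.single 2 1))) (pr 2) 0 := by
      refine (pr 2).hasFDerivAt.congr_of_eventuallyEq (.of_forall fun p => ?_)
      simp [fExDeriv, pr]
    have hcomp := (pr 0).hasFDerivAt.comp (0 : Fin 3 → ℝ)
      (hdiff.hasFDerivAt.clm_apply (hasFDerivAt_const (Pi.single 2 1 : Fin 3 → ℝ) 0))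
    have heq := congrArg (fun L => L (Pi.single 2 1)) (hentry.unique hcomp)
    simp [hzero] at heq
    simp [pr] at heq
end

section
/- Let d be a natural number with d ≥ 1 and d ≠ 2. Let φ be a real-valued function of class C^{d+2} on a neighborhood of 0 in ℝ with φ(0) = 0 and φ'(0) = 1. Define E(x) = φ'(x)·x^d − (φ(x))^d. If E^{(j)}(0) = 0 for all 0 ≤ j ≤ d+1, then φ''(0) = 0. (The geometric structure given by the vector field x^d ∂/∂x on ℝ, degenerate at the origin, is (d+2,1)-sub-rigid at 0: a (d+2)-infinitesimal isometry with trivial 1-jet at 0 has trivial 2-jet.) -/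
open Filter Topology Asymptotics

/-- Taylor's theorem with Peano remainder at the origin. -/
lemma ContDiffOn.sub_sum_iteratedDeriv_isLittleO {f : ℝ → ℝ} {n : ℕ} {U : Set ℝ}
    (hU : IsOpen U) (hU0 : (0 : ℝ) ∈ U) (hf : ContDiffOn ℝ n f U) :
    (fun x ↦ f x - ∑ k ∈ Finset.range (n + 1), iteratedDeriv k f 0 / k.factorial * x ^ k)
      =o[𝓝 0] fun x ↦ x ^ n := by
  obtain ⟨ε, hε, hball⟩ := Metric.isOpen_iff.1 hU 0 hU0
  have h := taylor_isLittleO (convex_ball (0 : ℝ) ε) (Metric.mem_ball_self hε) (hf.mono hball)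
  rw [Metric.isOpen_ball.nhdsWithin_eq (Metric.mem_ball_self hε)] at h
  refine h.congr (fun x ↦ ?_) (fun x ↦ by simp)
  rw [taylor_within_apply]
  refine congrArg _ (Finset.sum_congr rfl fun k _ ↦ ?_)
  rw [iteratedDerivWithin_of_isOpen Metric.isOpen_ball (Metric.mem_ball_self hε), sub_zero,
    smul_eq_mul]
  ring

/-- The defect divided by `x ^ (d + 1)` tends to `(1 - d / 2) φ''(0)`. -/
lemma tendsto_isometry_defect_div {φ : ℝ → ℝ} {a : ℝ} (d : ℕ)
    (hφ' : Tendsto (fun x ↦ (deriv φ x - 1) / x) (𝓝[≠] 0) (𝓝 a))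
    (hφ : Tendsto (fun x ↦ (φ x - x) / x ^ 2) (𝓝[≠] 0) (𝓝 (a / 2))) :
    Tendsto (fun x ↦ (deriv φ x * x ^ d - φ x ^ d) / x ^ (d + 1)) (𝓝[≠] 0)
      (𝓝 (a - a / 2 * d)) := by
  have hx : Tendsto (fun x : ℝ ↦ x) (𝓝[≠] 0) (𝓝 0) := tendsto_id.mono_left nhdsWithin_le_nhds
  have hq : Tendsto (fun x ↦ 1 + x * ((φ x - x) / x ^ 2)) (𝓝[≠] 0) (𝓝 1) := by
    simpa using (hx.mul hφ).const_add 1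
  have hsum : Tendsto (fun x ↦ ∑ i ∈ Finset.range d, (1 + x * ((φ x - x) / x ^ 2)) ^ i)
      (𝓝[≠] 0) (𝓝 (d : ℝ)) := by
    simpa using tendsto_finsetSum (Finset.range d) fun i _ ↦ hq.pow i
  refine (hφ'.sub (hφ.mul hsum)).congr' ?_
  filter_upwards [self_mem_nhdsWithin] with x (hx0 : x ≠ 0)
  have hgeom := geom_sum_mul (1 + x * ((φ x - x) / x ^ 2)) d
  have hratio : 1 + x * ((φ x - x) / x ^ 2) = φ x / x := by field_simp; ring
  have hr : (φ x - x) / x ^ 2 = (φ x / x - 1) / x := by field_simp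
  rw [hratio] at hgeom ⊢
  rw [hr, div_mul_eq_mul_div, mul_comm (φ x / x - 1), hgeom, div_pow]
  field_simp
  ring

/-- **The geometric structure given by the vector field `x^d ∂/∂x` on `ℝ`, degenerate at
the origin, is `(d+2, 1)`-sub-rigid at `0`:** if `φ` is `C^{d+2}` near `0` with `φ(0) = 0`
and `φ'(0) = 1` (trivial `1`-jet), and the isometry defect
`E(x) = φ'(x) x^d − (φ x)^d` has all derivatives of order `≤ d+1` vanishing at `0`
(`φ` is a `(d+2)`-infinitesimal isometry), then `φ''(0) = 0` (trivial `2`-jet). -/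
theorem degenerate_vector_field_sub_rigid (d : ℕ) (hd : 1 ≤ d) (hd2 : d ≠ 2)
    (U : Set ℝ) (hU : IsOpen U) (hU0 : (0 : ℝ) ∈ U)
    (φ : ℝ → ℝ) (hφ : ContDiffOn ℝ (d + 2 : ℕ) φ U)
    (hφ0 : φ 0 = 0) (hφ'0 : deriv φ 0 = 1)
    (hE : ∀ j ≤ d + 1,
      iteratedDeriv j (fun x : ℝ => deriv φ x * x ^ d - (φ x) ^ d) 0 = 0) :
    deriv (deriv φ) 0 = 0 := by
  have hφ1 : ContDiffOn ℝ (d + 1 : ℕ) (deriv φ) U :=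
    hφ.deriv_of_isOpen hU (by norm_cast)
  have hdiff : DifferentiableAt ℝ (deriv φ) 0 :=
    (hφ1.contDiffAt (hU.mem_nhds hU0)).differentiableAt (by norm_cast)
  have hslope : Tendsto (fun x ↦ (deriv φ x - 1) / x) (𝓝[≠] 0) (𝓝 (deriv (deriv φ) 0)) := by
    refine (hasDerivAt_iff_tendsto_slope.1 hdiff.hasDerivAt).congr fun x ↦ ?_
    rw [slope_def_field, hφ'0, sub_zero]
  have hquad : Tendsto (fun x ↦ (φ x - x) / x ^ 2) (𝓝[≠] 0) (𝓝 (deriv (deriv φ) 0 / 2)) := by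
    have h := (ContDiffOn.sub_sum_iteratedDeriv_isLittleO (n := 2) hU hU0
      (hφ.of_le (by norm_cast; omega))).tendsto_div_nhds_zero.mono_left
        (nhdsWithin_le_nhds (s := {0}ᶜ))
    have h' := h.add_const (deriv (deriv φ) 0 / 2)
    rw [zero_add] at h'
    refine h'.congr' ?_
    filter_upwards [self_mem_nhdsWithin] with x (hx0 : x ≠ 0)
    simp only [Finset.sum_range_succ, Finset.sum_range_zero, iteratedDeriv_succ,
      iteratedDeriv_zero, hφ0, hφ'0, Nat.factorial]
    field_simp
    push_cast
    ring
  have hE0 : Tendsto (fun x ↦ (deriv φ x * x ^ d - φ x ^ d) / x ^ (d + 1)) (𝓝[≠] 0) (𝓝 0) := by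
    have hsmooth : ContDiffOn ℝ (d + 1 : ℕ) (fun x ↦ deriv φ x * x ^ d - φ x ^ d) U :=
      (hφ1.mul (contDiffOn_id.pow d)).sub ((hφ.of_le (by norm_cast; omega)).pow d)
    have h := hsmooth.sub_sum_iteratedDeriv_isLittleO hU hU0
    refine (h.tendsto_div_nhds_zero.mono_left nhdsWithin_le_nhds).congr fun x ↦ ?_
    rw [Finset.sum_eq_zero, sub_zero]
    intro k hk
    rw [hE k (Nat.lt_succ_iff.1 (Finset.mem_range.1 hk)), zero_div, zero_mul]
  have hlim := tendsto_nhds_unique (tendsto_isometry_defect_div d hslope hquad) hE0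
  have hd2' : (2 - d : ℝ) ≠ 0 := sub_ne_zero.2 (by exact_mod_cast hd2.symm)
  refine (mul_eq_zero.1 ?_).resolve_left hd2'
  linear_combination 2 * hlim
end

section
/- Let d ≥ 1 be a natural number and let φ : ℝ → ℝ be continuously differentiable with φ'(x) ≠ 0 for every x ∈ ℝ. If (φ(x))^{2d} · (φ'(x))² = x^{2d} for all x ∈ ℝ, then either φ(x) = x for all x, or φ(x) = −x for all x. (Every global isometry of the singular Riemannian metric g = x^{2d} dx² on ℝ is ± the identity.) -/
/-- An orientation-preserving isometry of `x^{2d} dx²` on `ℝ` is the identity. -/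
theorem singular_metric_isometry_eq_id_of_deriv_pos (d : ℕ) (hd : 1 ≤ d)
    (φ : ℝ → ℝ) (hφ : Differentiable ℝ φ) (hφ' : ∀ x : ℝ, 0 < deriv φ x)
    (hiso : ∀ x : ℝ, (φ x) ^ (2 * d) * (deriv φ x) ^ 2 = x ^ (2 * d)) (x : ℝ) :
    φ x = x := by
  have hmono : StrictMono φ := strictMono_of_deriv_pos hφ'
  have h0 : φ 0 = 0 := by
    have h := hiso 0
    rw [zero_pow (by omega)] at h
    rcases mul_eq_zero.mp h with h | h
    · exact eq_zero_of_pow_eq_zero h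
    · exact absurd (eq_zero_of_pow_eq_zero h) (hφ' 0).ne'
  have hsign : ∀ y : ℝ, 0 ≤ φ y * y := by
    intro y
    rcases le_total 0 y with hy | hy
    · exact mul_nonneg (h0 ▸ hmono.monotone hy) hy
    · exact mul_nonneg_of_nonpos_of_nonpos (h0 ▸ hmono.monotone hy) hy
  have hode : ∀ y : ℝ, φ y ^ d * deriv φ y = y ^ d := by
    intro y
    have hsq : (φ y ^ d * deriv φ y) ^ 2 = (y ^ d) ^ 2 := by
      rw [mul_pow, ← pow_mul, ← pow_mul, mul_comm d 2]
      exact hiso y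
    have hnonneg : 0 ≤ (φ y ^ d * deriv φ y) * y ^ d := by
      rw [mul_right_comm, ← mul_pow]
      exact mul_nonneg (pow_nonneg (hsign y) d) (hφ' y).le
    rcases sq_eq_sq_iff_eq_or_eq_neg.mp hsq with h | h
    · exact h
    · rw [h] at hnonneg
      have hy : y ^ d = 0 := by nlinarith [sq_nonneg (y ^ d)]
      rw [h, hy, neg_zero]
  have hderiv : ∀ y : ℝ, HasDerivAt (fun z => φ z ^ (d + 1) - z ^ (d + 1)) 0 y := by
    intro y
    have h := ((hφ y).hasDerivAt.fun_pow (d + 1)).fun_sub (hasDerivAt_pow (d + 1) y)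
    rwa [Nat.add_sub_cancel, mul_assoc, hode y, sub_self] at h
  have hconst := is_const_of_deriv_eq_zero (fun y => (hderiv y).differentiableAt)
    (fun y => (hderiv y).deriv) x 0
  have hpow : φ x ^ (d + 1) = x ^ (d + 1) := by
    simpa [h0, sub_eq_zero] using hconst
  have habs : |φ x| = |x| := by
    refine (pow_left_inj₀ (abs_nonneg _) (abs_nonneg _) d.succ_ne_zero).mp ?_
    rw [← abs_pow, ← abs_pow, hpow]
  rcases abs_eq_abs.mp habs with h | h
  · exact h
  · have hx := hsign x
    rw [h] at hx
    have : x = 0 := by nlinarith [sq_nonneg x]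
    rw [h, this, neg_zero]

/-- **Every global isometry of the singular Riemannian metric `g = x^{2d} dx²` on `ℝ`
is plus or minus the identity.**
A `C¹` map `φ` with nonvanishing derivative satisfies `φ*g = g` precisely when
`(φ x)^{2d} * (φ' x)² = x^{2d}` for all `x`. -/
theorem singular_metric_global_isometry (d : ℕ) (hd : 1 ≤ d)
    (φ : ℝ → ℝ) (hφ : ContDiff ℝ 1 φ) (hφ' : ∀ x : ℝ, deriv φ x ≠ 0)
    (hiso : ∀ x : ℝ, (φ x) ^ (2 * d) * (deriv φ x) ^ 2 = x ^ (2 * d)) :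
    (∀ x : ℝ, φ x = x) ∨ (∀ x : ℝ, φ x = -x) := by
  have hdiff : Differentiable ℝ φ := hφ.differentiable one_ne_zero
  have hcont : Continuous (deriv φ) := hφ.continuous_deriv le_rfl
  rcases (lt_or_gt_of_ne (hφ' 0)) with h0 | h0
  · right
    have hneg : ∀ x, deriv φ x < 0 := by
      intro x
      by_contra! h
      obtain ⟨c, hc⟩ := mem_range_of_exists_le_of_exists_ge hcont ⟨0, h0.le⟩ ⟨x, h⟩
      exact hφ' c hc
    have hderiv : ∀ x, deriv (fun y => -φ y) x = -deriv φ x := fun x => deriv.fun_neg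
    intro x
    refine neg_eq_iff_eq_neg.mp
      (singular_metric_isometry_eq_id_of_deriv_pos d hd (fun y => -φ y) hdiff.neg
        (fun y => ?_) (fun y => ?_) x)
    · rw [hderiv]
      exact neg_pos.mpr (hneg y)
    · rw [hderiv, (even_two_mul d).neg_pow, neg_sq]
      exact hiso y
  · left
    refine singular_metric_isometry_eq_id_of_deriv_pos d hd φ hdiff (fun x => ?_) hiso
    by_contra! h
    obtain ⟨c, hc⟩ := mem_range_of_exists_le_of_exists_ge hcont ⟨x, h⟩ ⟨0, h0.le⟩
    exact hφ' c hc
end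

section
/- Let d ≥ 1 be a natural number and let V : ℝ → ℝ be continuous on ℝ and differentiable on ℝ ∖ {0}, satisfying x·V'(x) + d·V(x) = 0 for all x ≠ 0. Then V(x) = 0 for all x ∈ ℝ. (No nonzero local Killing field of the singular metric x^{2d} dx² on ℝ ∖ {0} extends continuously across the singular point 0; in particular the extension property of Killing fields valid for rigid analytic structures fails for this sub-rigid structure.) -/
/-- A continuous real function vanishing at `0` whose derivative vanishes away from `0` is zero. -/
theorem eq_zero_of_hasDerivAt_zero_off_zero {f : ℝ → ℝ} (hc : Continuous f) (h0 : f 0 = 0)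
    (hf : ∀ x : ℝ, x ≠ 0 → HasDerivAt f 0 x) (x : ℝ) : f x = 0 := by
  rcases eq_or_ne x 0 with rfl | hx
  · exact h0
  obtain ⟨c, -, h⟩ := exists_hasDerivAt_eq_slope (fun t => f (t * x)) (fun _ => 0)
    zero_lt_one (by fun_prop) (fun t ht =>
      HasDerivAt.congr_deriv
        ((hf (t * x) (mul_ne_zero ht.1.ne' hx)).comp t ((hasDerivAt_id t).mul_const x))
        (zero_mul _))
  simpa [h0, eq_comm] using h

/-- **No nonzero local Killing field of the singular metric `x^{2d} dx²` on `ℝ ∖ {0}`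
extends continuously across the singular point `0`:** if `V` is continuous on `ℝ`,
differentiable away from `0`, and satisfies the Killing equation `x V'(x) + d V(x) = 0`
for `x ≠ 0`, then `V ≡ 0`. -/
theorem no_killing_field_extension (d : ℕ) (hd : 1 ≤ d)
    (V : ℝ → ℝ) (hVc : Continuous V)
    (hVd : ∀ x : ℝ, x ≠ 0 → DifferentiableAt ℝ V x)
    (hK : ∀ x : ℝ, x ≠ 0 → x * deriv V x + (d : ℝ) * V x = 0) :
    ∀ x : ℝ, V x = 0 := by
  have hf : ∀ x : ℝ, x ≠ 0 → HasDerivAt (fun y => y ^ d * V y) 0 x := by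
    intro x hx
    refine ((hasDerivAt_pow d x).mul (hVd x hx).hasDerivAt).congr_deriv ?_
    obtain ⟨n, rfl⟩ := Nat.exists_eq_add_of_le' hd
    rw [Nat.add_sub_cancel]
    linear_combination x ^ n * hK x hx
  have hne : ∀ x : ℝ, x ≠ 0 → V x = 0 := by
    intro x hx
    have h := eq_zero_of_hasDerivAt_zero_off_zero (f := fun y => y ^ d * V y)
      (by fun_prop) (by simp [Nat.one_le_iff_ne_zero.mp hd]) hf x
    exact (mul_eq_zero.mp h).resolve_left (pow_ne_zero d hx)
  have hV : V = fun _ => 0 :=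
    hVc.ext_on (dense_compl_singleton (0 : ℝ)) continuous_const hne
  exact congrFun hV
end

section
/- Let Q ⊆ ℝ^m be open and nonempty, let h : Q → Sym²(ℝ^m)* assign to each q a positive definite symmetric bilinear form h_q, and let c : Q × ℝ → ℝ be such that for every q ∈ Q the map r ↦ c(q,r) is a bijection of ℝ onto ℝ. Let ψ : Q → Q be differentiable and conformal for h with distortion f : Q → ℝ, f(q) > 0; that is, h_{ψ(q)}((Dψ_q)u, (Dψ_q)v) = f(q)·h_q(u,v) for all q ∈ Q and u, v ∈ ℝ^m. Then: (a) there exists a unique map δ : Q × ℝ → ℝ satisfying the cocycle equation c(ψ(q), δ(q,r)) · f(q) = c(q,r) for all (q,r) ∈ Q × ℝ; (b) for this δ, the map φ(q,r) = (ψ(q), δ(q,r)) preserves the lightlike metric g on Q × ℝ defined by g_{(q,r)}((u,s),(v,t)) = c(q,r)·h_q(u,v): at every point p = (q,r) at which δ is differentiable, g_{φ(p)}((Dφ_p)w, (Dφ_p)w') = g_p(w,w') for all w, w' ∈ ℝ^m × ℝ. (Every conformal transformation of (Q,h) admits a unique isometric lifting to the generic transversally conformal lightlike manifold (Q × ℝ,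 g).) -/
/-- **Every conformal transformation of `(Q, h)` admits a unique isometric lifting to the
generic transversally conformal lightlike manifold `(Q × ℝ, g)`**, where
`g_{(q,r)}((u,s),(v,t)) = c(q,r)·h_q(u,v)`.
Here `h_q` is positive definite symmetric for `q ∈ Q`, `r ↦ c(q,r)` is a bijection of `ℝ`
for each `q ∈ Q` (genericity), and `ψ : Q → Q` is conformal for `h` with distortion
`f > 0`.  Part (a): there is a unique `δ` with `c(ψ(q), δ(q,r))·f(q) = c(q,r)` on `Q × ℝ`.
Part (b): for this `δ`, the lift `φ(q,r) = (ψ(q), δ(q,r))` preserves `g` at every point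
where `δ` is differentiable. -/
theorem conformal_transformation_lifts_isometrically
    (m : ℕ) (Q : Set (Fin m → ℝ)) (hQ : IsOpen Q) (hQne : Q.Nonempty)
    (h : (Fin m → ℝ) → ((Fin m → ℝ) →L[ℝ] (Fin m → ℝ) →L[ℝ] ℝ))
    (hsym : ∀ q ∈ Q, ∀ u v : Fin m → ℝ, h q u v = h q v u)
    (hpos : ∀ q ∈ Q, ∀ u : Fin m → ℝ, u ≠ 0 → 0 < h q u u)
    (c : (Fin m → ℝ) → ℝ → ℝ)
    (hc : ∀ q ∈ Q, Function.Bijective (c q))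
    (ψ : (Fin m → ℝ) → (Fin m → ℝ))
    (hψQ : Set.MapsTo ψ Q Q) (hψd : DifferentiableOn ℝ ψ Q)
    (f : (Fin m → ℝ) → ℝ) (hf : ∀ q ∈ Q, 0 < f q)
    (hconf : ∀ q ∈ Q, ∀ u v : Fin m → ℝ,
      h (ψ q) (fderiv ℝ ψ q u) (fderiv ℝ ψ q v) = f q * h q u v) :
    ∃ δ : (Fin m → ℝ) × ℝ → ℝ,
      -- (a) existence and uniqueness of the cocycle solution
      (∀ q ∈ Q, ∀ r : ℝ, c (ψ q) (δ (q, r)) * f q = c q r) ∧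
      (∀ δ' : (Fin m → ℝ) × ℝ → ℝ,
        (∀ q ∈ Q, ∀ r : ℝ, c (ψ q) (δ' (q, r)) * f q = c q r) →
        ∀ q ∈ Q, ∀ r : ℝ, δ' (q, r) = δ (q, r)) ∧
      -- (b) the lift `φ = (ψ ∘ pr₁, δ)` is isometric for the lightlike metric `g`
      (∀ q ∈ Q, ∀ r : ℝ, DifferentiableAt ℝ δ (q, r) →
        ∀ w w' : (Fin m → ℝ) × ℝ,
          c (ψ q) (δ (q, r)) *
            h (ψ q) (fderiv ℝ (fun p : (Fin m → ℝ) × ℝ => (ψ p.1, δ p)) (q, r) w).1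
              (fderiv ℝ (fun p : (Fin m → ℝ) × ℝ => (ψ p.1, δ p)) (q, r) w').1
          = c q r * h q w.1 w'.1) := by
  have hδ : ∀ q ∈ Q, ∀ r : ℝ,
      c (ψ q) (Function.invFun (c (ψ q)) (c q r / f q)) * f q = c q r := by
    intro q hq r
    rw [Function.invFun_eq ((hc (ψ q) (hψQ hq)).surjective _), div_mul_cancel₀ _ (hf q hq).ne']
  refine ⟨fun p => Function.invFun (c (ψ p.1)) (c p.1 p.2 / f p.1), hδ, ?_, ?_⟩
  · intro δ' hδ' q hq r
    apply (hc (ψ q) (hψQ hq)).injective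
    exact mul_right_cancel₀ (hf q hq).ne' ((hδ' q hq r).trans (hδ q hq r).symm)
  · intro q hq r hdiff w w'
    have hψ : HasFDerivAt ψ (fderiv ℝ ψ q) q :=
      (hψd.differentiableAt (hQ.mem_nhds hq)).hasFDerivAt
    have hφ := (HasFDerivAt.comp (q, r) (f := Prod.fst) hψ hasFDerivAt_fst).prodMk
      hdiff.hasFDerivAt
    have hfst (x : (Fin m → ℝ) × ℝ) :
        (fderiv ℝ (fun p : (Fin m → ℝ) × ℝ =>
          (ψ p.1, Function.invFun (c (ψ p.1)) (c p.1 p.2 / f p.1))) (q, r) x).1 =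
          fderiv ℝ ψ q x.1 :=
      congrArg (fun L => (L x).1) hφ.fderiv
    rw [hfst, hfst, hconf q hq, ← mul_assoc]
    exact congrArg (· * h q w.1 w'.1) (hδ q hq r)
end
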